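/- arXiv:1408.2951 — 2 statements merged into one kernel-verified Lean document; each statement's English description precedes it below -/
import Mathlib

section
/- (Theorem 3, part 2) Let n, m be integers with m ≥ 1 and n − m ≥ 2, and let v₁, v₂ > 0. With π = π_SVS the singular value shrinkage prior, the marginals m_SVS(Z; v) are finite and positive for all Z and v > 0, and the Bayesian predictive density p̂_SVS dominates the predictive density p̂_I based on the uniform prior under the Kullback–Leibler risk: R_KL(M, p̂_SVS) ≤ R_KL(M, p̂_I) for every M ∈ ℝ^{n×m}, with strict inequality for some M. -/
open Matrix MeasureTheory ENNReal
open scoped Classical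

/-- The matrix in `ℝ^{n×m}` corresponding to a point of `ℝ^{nm}`
(the identification via entries). -/
def toMat {n m : ℕ} (x : EuclideanSpace ℝ (Fin n × Fin m)) : Matrix (Fin n) (Fin m) ℝ :=
  fun i a => x (i, a)

/-- The singular value shrinkage prior `π_SVS(M) = det(MᵀM)^{-(n-m-1)/2}` if `MᵀM` is
invertible, and `+∞` otherwise, viewed as a function on `ℝ^{nm}`. -/
noncomputable def piSVS (n m : ℕ) (x : EuclideanSpace ℝ (Fin n × Fin m)) : ℝ≥0∞ :=
  if IsUnit ((toMat x)ᵀ * toMat x).det then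
    ENNReal.ofReal ((((toMat x)ᵀ * toMat x).det) ^ (-(((n : ℝ) - m - 1)) / 2))
  else ⊤

/-- The density of the matrix-variate normal `N_{n,m}(M, v I_n, I_m)` at `X`, where
`ℝ^{n×m}` is identified with `ℝ^{nm}` and `‖·‖` is the (Frobenius) Euclidean norm. -/
noncomputable def pdens (n m : ℕ) (v : ℝ) (X M : EuclideanSpace ℝ (Fin n × Fin m)) : ℝ :=
  (2 * Real.pi * v) ^ (-((n : ℝ) * m) / 2) * Real.exp (-‖X - M‖ ^ 2 / (2 * v))

/-- The marginal `m_π(Z; v) = ∫ p_v(Z|M) π(M) dM` of a prior `π`. -/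
noncomputable def marg (n m : ℕ) (π : EuclideanSpace ℝ (Fin n × Fin m) → ℝ≥0∞) (v : ℝ)
    (Z : EuclideanSpace ℝ (Fin n × Fin m)) : ℝ≥0∞ :=
  ∫⁻ M, ENNReal.ofReal (pdens n m v Z M) * π M

/-- The Bayesian predictive density based on the prior `π`. -/
noncomputable def predPi (n m : ℕ) (π : EuclideanSpace ℝ (Fin n × Fin m) → ℝ≥0∞)
    (v₁ v₂ : ℝ) (Y Yt : EuclideanSpace ℝ (Fin n × Fin m)) : ℝ :=
  (∫⁻ M, ENNReal.ofReal (pdens n m v₂ Yt M * pdens n m v₁ Y M) * π M).toReal /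
    (marg n m π v₁ Y).toReal

/-- The predictive density based on the uniform prior: `p̂_I(Ỹ|Y) = p_{v₁+v₂}(Ỹ|Y)`. -/
noncomputable def predI (n m : ℕ) (v₁ v₂ : ℝ)
    (Y Yt : EuclideanSpace ℝ (Fin n × Fin m)) : ℝ :=
  pdens n m (v₁ + v₂) Yt Y

/-- The Kullback–Leibler risk of a predictive density `p̂(·|·)` at the parameter `M`. -/
noncomputable def RKL (n m : ℕ) (v₁ v₂ : ℝ) (M : EuclideanSpace ℝ (Fin n × Fin m))
    (phat : EuclideanSpace ℝ (Fin n × Fin m) → EuclideanSpace ℝ (Fin n × Fin m) → ℝ) : ℝ :=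
  ∫ p : EuclideanSpace ℝ (Fin n × Fin m) × EuclideanSpace ℝ (Fin n × Fin m),
    pdens n m v₁ p.1 M * pdens n m v₂ p.2 M *
      Real.log (pdens n m v₂ p.2 M / phat p.1 p.2)

lemma gauss1_exponent (t a c y : ℝ) (ht : 0 < t) (ha : 0 ≤ a) :
    -(c - y) ^ 2 / (2 * t) - a * y ^ 2 =
      -(a * c ^ 2 / (1 + 2 * a * t)) +
        -((1 + 2 * a * t) / (2 * t)) * (y - c / (1 + 2 * a * t)) ^ 2 := by
  have h1 : (1 + 2 * a * t) ≠ 0 := by positivity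
  field_simp
  ring

lemma gauss1_integrable (t a c : ℝ) (ht : 0 < t) (ha : 0 ≤ a) :
    Integrable (fun y : ℝ => (√(2 * Real.pi * t))⁻¹ *
      Real.exp (-(c - y) ^ 2 / (2 * t) - a * y ^ 2)) := by
  have h1 : 0 < (1 + 2 * a * t) / (2 * t) := by positivity
  simp_rw [gauss1_exponent t a c _ ht ha, Real.exp_add]
  exact (((integrable_exp_neg_mul_sq h1).comp_sub_right (c / (1 + 2 * a * t))).const_mul _).const_mul _

lemma gauss1 (t a c : ℝ) (ht : 0 < t) (ha : 0 ≤ a) :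
    ∫ y : ℝ, (√(2 * Real.pi * t))⁻¹ * Real.exp (-(c - y) ^ 2 / (2 * t) - a * y ^ 2) =
      (√(1 + 2 * a * t))⁻¹ * Real.exp (-(a * c ^ 2 / (1 + 2 * a * t))) := by
  have h0 : 0 < (1 + 2 * a * t) := by positivity
  simp_rw [gauss1_exponent t a c _ ht ha, Real.exp_add]
  rw [integral_const_mul, integral_const_mul,
    integral_sub_right_eq_self (fun y => Real.exp (-((1 + 2 * a * t) / (2 * t)) * y ^ 2)),
    integral_gaussian]
  have h2 : Real.pi / ((1 + 2 * a * t) / (2 * t)) = (2 * Real.pi * t) / (1 + 2 * a * t) := by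
    field_simp
  rw [h2, Real.sqrt_div (by positivity)]
  have h3 : √(2 * Real.pi * t) ≠ 0 := by positivity
  field_simp

lemma gaussN {ι : Type*} [Fintype ι]
    (b : OrthonormalBasis ι ℝ (EuclideanSpace ℝ ι)) (t : ℝ) (ht : 0 < t) (a : ι → ℝ)
    (ha : ∀ i, 0 ≤ a i) (x : EuclideanSpace ℝ ι) :
    ∫⁻ y : EuclideanSpace ℝ ι, ENNReal.ofReal (((√(2 * Real.pi * t))⁻¹ ^ Fintype.card ι *
        Real.exp (-‖x - y‖ ^ 2 / (2 * t))) * Real.exp (-∑ i, a i * (b.repr y i) ^ 2)) =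
      ENNReal.ofReal (∏ i, ((√(1 + 2 * a i * t))⁻¹ *
        Real.exp (-(a i * (b.repr x i) ^ 2 / (1 + 2 * a i * t))))) := by
  have key : ∀ y : EuclideanSpace ℝ ι, ((√(2 * Real.pi * t))⁻¹ ^ Fintype.card ι *
        Real.exp (-‖x - y‖ ^ 2 / (2 * t))) * Real.exp (-∑ i, a i * (b.repr y i) ^ 2) =
      ∏ i, (√(2 * Real.pi * t))⁻¹ *
        Real.exp (-(b.repr x i - (b.repr y) i) ^ 2 / (2 * t) - a i * (b.repr y i) ^ 2) := by
    intro y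
    rw [Finset.prod_mul_distrib, Finset.prod_const, Finset.card_univ, ← Real.exp_sum, mul_assoc,
      ← Real.exp_add]
    congr 2
    rw [Finset.sum_sub_distrib, ← Finset.sum_div, Finset.sum_neg_distrib, ← sub_eq_add_neg,
      ← b.repr.norm_map (x - y), EuclideanSpace.norm_sq_eq]
    simp
  simp_rw [key]
  rw [b.measurePreserving_repr.lintegral_comp_emb b.repr.toMeasurableEquiv.measurableEmbedding
    (fun z : EuclideanSpace ℝ ι => ENNReal.ofReal (∏ i, (√(2 * Real.pi * t))⁻¹ *
        Real.exp (-(b.repr x i - z i) ^ 2 / (2 * t) - a i * (z i) ^ 2)))]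
  rw [← (PiLp.volume_preserving_toLp ι).lintegral_comp_emb
    (MeasurableEquiv.toLp 2 (ι → ℝ)).measurableEmbedding]
  simp only
  rw [← ofReal_integral_eq_lintegral_ofReal]
  · rw [integral_fintype_prod_volume_eq_prod (fun i y => (√(2 * Real.pi * t))⁻¹ *
        Real.exp (-(b.repr x i - y) ^ 2 / (2 * t) - a i * y ^ 2))]
    simp_rw [fun i => gauss1 t (a i) (b.repr x i) ht (ha i)]
  · exact Integrable.fintype_prod (f := fun i y => (√(2 * Real.pi * t))⁻¹ *
        Real.exp (-(b.repr x i - y) ^ 2 / (2 * t) - a i * y ^ 2))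
        (fun i => gauss1_integrable t (a i) (b.repr x i) ht (ha i))
  · exact Filter.Eventually.of_forall fun y => Finset.prod_nonneg fun i _ => by positivity

noncomputable def newtonN (β q : ℝ) : ℝ≥0∞ :=
  ∫⁻ s in Set.Ioi (0 : ℝ), ENNReal.ofReal (s ^ (β - 1) * Real.exp (-(s * q)))

lemma newton_cov (β c q : ℝ) (hc : 0 ≤ c) :
    ∫⁻ s in Set.Ioi (0 : ℝ), ENNReal.ofReal (s ^ (β - 1) *
      ((1 + c * s) ^ (-(β + 1)) * Real.exp (-(s * q / (1 + c * s))))) ≤ newtonN β q := by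
  have hpos : ∀ s ∈ Set.Ioi (0 : ℝ), 0 < 1 + c * s := fun s hs => by
    have : 0 < s := hs
    positivity
  have h := lintegral_image_eq_lintegral_abs_deriv_mul (s := Set.Ioi (0 : ℝ))
    (f := fun s => s / (1 + c * s)) (f' := fun s => 1 / (1 + c * s) ^ 2) measurableSet_Ioi
    (by
      intro s hs
      have hp := (hpos s hs).ne'
      have h1 : HasDerivAt (fun s : ℝ => 1 + c * s) c s := by
        simpa using ((hasDerivAt_id s).const_mul c).const_add 1
      have := ((hasDerivAt_id s).div h1 hp).hasDerivWithinAt (s := Set.Ioi (0 : ℝ))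
      have e : 1 / (1 + c * s) ^ 2 = (1 * (1 + c * s) - s * c) / (1 + c * s) ^ 2 := by
        congr 1
        ring
      rw [e]
      exact this)
    (by
      intro s hs s' hs' h
      have hp := (hpos s hs).ne'
      have hp' := (hpos s' hs').ne'
      simp only at h
      rw [div_eq_div_iff hp hp'] at h
      linarith)
    (fun u => ENNReal.ofReal (u ^ (β - 1) * Real.exp (-(u * q))))
  calc _ = ∫⁻ s in Set.Ioi (0 : ℝ), ENNReal.ofReal |1 / (1 + c * s) ^ 2| *
        ENNReal.ofReal ((s / (1 + c * s)) ^ (β - 1) * Real.exp (-(s / (1 + c * s) * q))) := by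
        refine setLIntegral_congr_fun measurableSet_Ioi fun s hs => ?_
        have hp := hpos s hs
        have hs0 : 0 < s := hs
        rw [← ENNReal.ofReal_mul (abs_nonneg _), abs_of_nonneg (by positivity),
          Real.div_rpow hs0.le hp.le]
        congr 1
        have e1 : s * q / (1 + c * s) = s / (1 + c * s) * q := by ring
        have e2 : (1 + c * s) ^ (-(β + 1)) = 1 / (1 + c * s) ^ 2 / (1 + c * s) ^ (β - 1) := by
          rw [← Real.rpow_natCast (1 + c * s) 2, one_div, ← Real.rpow_neg hp.le,
            ← Real.rpow_sub hp]
          congr 1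
          push_cast
          ring
        rw [e1, e2]
        ring
    _ = _ := h.symm
    _ ≤ newtonN β q := by
        unfold newtonN
        refine lintegral_mono_set ?_
        rintro _ ⟨s, hs, rfl⟩
        exact div_pos hs (hpos s hs)

lemma newtonN_measurable (β : ℝ) : Measurable (newtonN β) := by
  unfold newtonN
  refine Measurable.lintegral_prod_right' (f := fun p : ℝ × ℝ =>
    ENNReal.ofReal (p.2 ^ (β - 1) * Real.exp (-(p.2 * p.1)))) ?_
  fun_prop

lemma newton_super {ι : Type*} [Fintype ι]
    (b : OrthonormalBasis ι ℝ (EuclideanSpace ℝ ι)) (t c β : ℝ) (ht : 0 < t) (hc : 0 ≤ c)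
    (l : ι → ℝ) (hl : ∀ i, l i = 0 ∨ l i = 1) (hsum : ∑ i, l i = 2 * (β + 1))
    (x : EuclideanSpace ℝ ι) :
    ∫⁻ y : EuclideanSpace ℝ ι, ENNReal.ofReal ((√(2 * Real.pi * t))⁻¹ ^ Fintype.card ι *
        Real.exp (-‖x - y‖ ^ 2 / (2 * t))) * newtonN β (c * ∑ i, l i * (b.repr y i) ^ 2) ≤
      newtonN β (c * ∑ i, l i * (b.repr x i) ^ 2) := by
  have hl0 : ∀ i, 0 ≤ l i := fun i => by rcases hl i with h | h <;> simp [h]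
  have hm : Measurable (fun y : EuclideanSpace ℝ ι => c * ∑ i, l i * (b.repr y i) ^ 2) := by
    have : Continuous (fun y : EuclideanSpace ℝ ι => c * ∑ i, l i * (b.repr y i) ^ 2) := by
      fun_prop
    exact this.measurable
  calc _ = ∫⁻ y : EuclideanSpace ℝ ι, ∫⁻ s in Set.Ioi (0 : ℝ),
        ENNReal.ofReal ((√(2 * Real.pi * t))⁻¹ ^ Fintype.card ι *
        Real.exp (-‖x - y‖ ^ 2 / (2 * t))) * ENNReal.ofReal (s ^ (β - 1) *
          Real.exp (-(s * (c * ∑ i, l i * (b.repr y i) ^ 2)))) := by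
        refine lintegral_congr fun y => ?_
        rw [lintegral_const_mul]
        · rfl
        · fun_prop
    _ = ∫⁻ s in Set.Ioi (0 : ℝ), ∫⁻ y : EuclideanSpace ℝ ι,
        ENNReal.ofReal ((√(2 * Real.pi * t))⁻¹ ^ Fintype.card ι *
        Real.exp (-‖x - y‖ ^ 2 / (2 * t))) * ENNReal.ofReal (s ^ (β - 1) *
          Real.exp (-(s * (c * ∑ i, l i * (b.repr y i) ^ 2)))) := by
        refine lintegral_lintegral_swap ?_
        refine Measurable.aemeasurable ?_
        have h1 : Measurable (fun p : EuclideanSpace ℝ ι × ℝ =>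
          c * ∑ i, l i * (b.repr p.1 i) ^ 2) := hm.comp measurable_fst
        have h2 : Measurable (fun p : EuclideanSpace ℝ ι × ℝ => ENNReal.ofReal (p.2 ^ (β - 1) *
          Real.exp (-(p.2 * (c * ∑ i, l i * (b.repr p.1 i) ^ 2))))) :=
          ENNReal.measurable_ofReal.comp ((measurable_snd.pow_const _).mul
            (Real.measurable_exp.comp (measurable_snd.mul h1).neg))
        have h3 : Measurable (fun p : EuclideanSpace ℝ ι × ℝ =>
          ENNReal.ofReal ((√(2 * Real.pi * t))⁻¹ ^ Fintype.card ι *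
            Real.exp (-‖x - p.1‖ ^ 2 / (2 * t)))) := by fun_prop
        exact h3.mul h2
    _ = ∫⁻ s in Set.Ioi (0 : ℝ), ENNReal.ofReal (s ^ (β - 1) *
      ((1 + (2 * c * t) * s) ^ (-(β + 1)) *
        Real.exp (-(s * (c * ∑ i, l i * (b.repr x i) ^ 2) / (1 + (2 * c * t) * s))))) := by
        refine setLIntegral_congr_fun measurableSet_Ioi fun s hs => ?_
        have hs0 : 0 < s := hs
        have hp : 0 < 1 + 2 * c * t * s := by positivity
        have e1 : ∀ y : EuclideanSpace ℝ ι, ENNReal.ofReal ((√(2 * Real.pi * t))⁻¹ ^ Fintype.card ι *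
            Real.exp (-‖x - y‖ ^ 2 / (2 * t))) * ENNReal.ofReal (s ^ (β - 1) *
              Real.exp (-(s * (c * ∑ i, l i * (b.repr y i) ^ 2)))) =
            ENNReal.ofReal (s ^ (β - 1)) * ENNReal.ofReal (((√(2 * Real.pi * t))⁻¹ ^ Fintype.card ι *
              Real.exp (-‖x - y‖ ^ 2 / (2 * t))) *
                Real.exp (-∑ i, (s * c * l i) * (b.repr y i) ^ 2)) := by
          intro y
          rw [← ENNReal.ofReal_mul (by positivity), ← ENNReal.ofReal_mul (by positivity)]
          congr 1
          have : s * (c * ∑ i, l i * (b.repr y i) ^ 2) = ∑ i, (s * c * l i) * (b.repr y i) ^ 2 := by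
            rw [← mul_assoc, Finset.mul_sum]
            exact Finset.sum_congr rfl fun i _ => by ring
          rw [this]
          ring
        simp only
        simp_rw [e1]
        rw [lintegral_const_mul', gaussN b t ht _ (fun i => by have := hl0 i; positivity) x,
          ← ENNReal.ofReal_mul (by positivity)]
        swap
        · exact ENNReal.ofReal_ne_top
        congr 2
        have e2 : ∀ i, (√(1 + 2 * (s * c * l i) * t))⁻¹ =
            (1 + 2 * c * t * s) ^ (-(l i / 2)) := by
          intro i
          rcases hl i with h | h
          · simp [h]
          · rw [h, Real.sqrt_eq_rpow, ← Real.rpow_neg]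
            · congr 1
              ring
            · positivity
        have e3 : ∀ i, (s * c * l i) * (b.repr x i) ^ 2 / (1 + 2 * (s * c * l i) * t) =
            s * c / (1 + 2 * c * t * s) * (l i * (b.repr x i) ^ 2) := by
          intro i
          rcases hl i with h | h
          · simp [h]
          · rw [h]
            have : 1 + 2 * (s * c * 1) * t = 1 + 2 * c * t * s := by ring
            rw [this]
            field_simp
        simp_rw [e2, e3]
        rw [Finset.prod_mul_distrib, ← Real.exp_sum, ← Real.rpow_sum_of_pos hp]
        congr 2
        · rw [Finset.sum_neg_distrib, ← Finset.sum_div, hsum]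
          ring
        · rw [Finset.sum_neg_distrib, ← Finset.mul_sum]
          ring
    _ ≤ _ := newton_cov _ _ _ (by positivity)

lemma proj_quadratic {n : ℕ} (H : Matrix (Fin n) (Fin n) ℝ) (hT : Hᵀ = H) (hI : H * H = H) :
    ∃ (b : OrthonormalBasis (Fin n) ℝ (EuclideanSpace ℝ (Fin n))) (l : Fin n → ℝ),
      (∀ i, l i = 0 ∨ l i = 1) ∧ (∑ i, l i = H.trace) ∧
      ∀ y : Fin n → ℝ, y ⬝ᵥ (H *ᵥ y) = ∑ i, l i * (b.repr (WithLp.toLp 2 y) i) ^ 2 := by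
  have hH : H.IsHermitian := by
    rw [Matrix.IsHermitian, Matrix.conjTranspose_eq_transpose_of_trivial, hT]
  refine ⟨hH.eigenvectorBasis, hH.eigenvalues, ?_, ?_, ?_⟩
  · intro i
    have h1 := hH.mulVec_eigenvectorBasis i
    have h2 : H *ᵥ (H *ᵥ (hH.eigenvectorBasis i).ofLp) = H *ᵥ (hH.eigenvectorBasis i).ofLp := by
      rw [Matrix.mulVec_mulVec, hI]
    rw [h1, Matrix.mulVec_smul, h1, smul_smul] at h2
    have h3 : (hH.eigenvectorBasis i).ofLp ≠ 0 := by
      intro h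
      have := hH.eigenvectorBasis.orthonormal.ne_zero i
      exact this (by ext k; simp [h])
    have h4 := smul_left_injective ℝ h3 h2
    have h5 : hH.eigenvalues i * (hH.eigenvalues i - 1) = 0 := by linarith
    rcases mul_eq_zero.1 h5 with h | h
    · exact Or.inl h
    · exact Or.inr (by linarith)
  · rw [hH.trace_eq_sum_eigenvalues]
    simp
  · intro y
    have h0 : y ⬝ᵥ (H *ᵥ y) = inner ℝ (WithLp.toLp 2 y : EuclideanSpace ℝ (Fin n))
        (WithLp.toLp 2 (H *ᵥ y)) := by
      rw [EuclideanSpace.inner_toLp_toLp]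
      simp [dotProduct_comm]
    rw [h0, ← hH.eigenvectorBasis.sum_inner_mul_inner]
    refine Finset.sum_congr rfl fun i _ => ?_
    have h1 : inner ℝ (hH.eigenvectorBasis i) (WithLp.toLp 2 (H *ᵥ y)) =
        hH.eigenvalues i * inner ℝ (hH.eigenvectorBasis i) (WithLp.toLp 2 y) := by
      have e1 : ∀ z : Fin n → ℝ, inner ℝ (hH.eigenvectorBasis i) (WithLp.toLp 2 z) =
          (hH.eigenvectorBasis i).ofLp ⬝ᵥ z := by
        intro z
        conv_lhs => rw [← WithLp.toLp_ofLp 2 (hH.eigenvectorBasis i)]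
        rw [EuclideanSpace.inner_toLp_toLp]
        simp [dotProduct_comm]
      rw [e1, e1, Matrix.dotProduct_mulVec, ← Matrix.mulVec_transpose, hT,
        hH.mulVec_eigenvectorBasis, smul_dotProduct, smul_eq_mul]
    rw [h1, hH.eigenvectorBasis.repr_apply_apply, real_inner_comm]
    ring

lemma gram_update {n m : ℕ} (M : Matrix (Fin n) (Fin m) ℝ) (hM : (Mᵀ * M).det ≠ 0) (j : Fin m) :
    ∃ (b : OrthonormalBasis (Fin n) ℝ (EuclideanSpace ℝ (Fin n))) (l : Fin n → ℝ) (c : ℝ),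
      0 < c ∧ (∀ i, l i = 0 ∨ l i = 1) ∧ (∑ i, l i = (n : ℝ) - m + 1) ∧
      ∀ y : Fin n → ℝ, ((M.updateCol j y)ᵀ * (M.updateCol j y)).det =
        c * ∑ i, l i * (b.repr (WithLp.toLp 2 y) i) ^ 2 := by
  have hps : (Mᵀ * M).PosSemidef := by
    have := Matrix.posSemidef_conjTranspose_mul_self M
    rwa [Matrix.conjTranspose_eq_transpose_of_trivial] at this
  have hpd : (Mᵀ * M).PosDef := hps.posDef_iff_det_ne_zero.2 hM
  let A : Matrix (Fin n) {i : Fin m // i ≠ j} ℝ := M.submatrix id Subtype.val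
  have hApd : (Aᵀ * A).PosDef := by
    have := hpd.submatrix (e := (Subtype.val : {i : Fin m // i ≠ j} → Fin m))
      Subtype.val_injective
    exact this
  have hAdet : 0 < (Aᵀ * A).det := hApd.det_pos
  have hAu : IsUnit (Aᵀ * A).det := hAdet.ne'.isUnit
  let G := (Aᵀ * A)⁻¹
  have hGT : Gᵀ = G := by
    simp only [G]
    rw [Matrix.transpose_nonsing_inv, Matrix.transpose_mul, Matrix.transpose_transpose]
  have hGA : G * (Aᵀ * A) = 1 := Matrix.nonsing_inv_mul _ hAu
  let H : Matrix (Fin n) (Fin n) ℝ := 1 - A * G * Aᵀ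
  have hT : Hᵀ = H := by
    simp only [H]
    rw [Matrix.transpose_sub, Matrix.transpose_one, Matrix.transpose_mul, Matrix.transpose_mul,
      hGT, Matrix.transpose_transpose, Matrix.mul_assoc]
  have hKK : (A * G * Aᵀ) * (A * G * Aᵀ) = A * G * Aᵀ := by
    calc (A * G * Aᵀ) * (A * G * Aᵀ) = A * (G * (Aᵀ * A)) * G * Aᵀ := by
          simp only [Matrix.mul_assoc]
      _ = _ := by rw [hGA, Matrix.mul_one]
  have hI : H * H = H := by
    simp only [H]
    rw [Matrix.sub_mul, Matrix.mul_sub, Matrix.mul_sub, hKK]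
    simp
  have htr : H.trace = (n : ℝ) - m + 1 := by
    simp only [H]
    rw [Matrix.trace_sub, Matrix.mul_assoc, Matrix.trace_mul_comm, Matrix.mul_assoc, hGA,
      Matrix.trace_one, Matrix.trace_one, Fintype.card_fin, Fintype.card_subtype_compl]
    have : 1 ≤ m := by have := j.2; omega
    simp [Nat.cast_sub this]
    ring
  obtain ⟨b, l, hl, hs, hq⟩ := proj_quadratic H hT hI
  refine ⟨b, l, (Aᵀ * A).det, hAdet, hl, hs.trans htr, fun y => ?_⟩
  rw [← hq y]
  let U := {i : Fin m // ¬ i ≠ j}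
  have : Unique U := ⟨⟨⟨j, by simp⟩⟩, fun a => Subtype.ext (by simpa using a.2)⟩
  let e : {i : Fin m // i ≠ j} ⊕ U ≃ Fin m := Equiv.sumCompl (fun i => i ≠ j)
  let B : Matrix (Fin n) U ℝ := fun i _ => y i
  have hblock : (((M.updateCol j y)ᵀ * (M.updateCol j y)).submatrix e e) =
      Matrix.fromBlocks (Aᵀ * A) (Aᵀ * B) (Bᵀ * A) (Bᵀ * B) := by
    have hU : ∀ u : U, u.1 = j := fun u => by simpa using u.2
    have h1 : ∀ (i : Fin n) (k : {i : Fin m // i ≠ j}), M.updateCol j y i (e (Sum.inl k)) = A i k := by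
      intro i k
      have : e (Sum.inl k) = k.1 := rfl
      rw [this, Matrix.updateCol_apply, if_neg k.2]
      rfl
    have h2 : ∀ (i : Fin n) (k : U), M.updateCol j y i (e (Sum.inr k)) = B i k := by
      intro i k
      have : e (Sum.inr k) = j := hU k
      rw [this, Matrix.updateCol_apply, if_pos rfl]
    ext (i | i) (k | k) <;>
      simp only [Matrix.submatrix_apply, Matrix.mul_apply, Matrix.transpose_apply,
        Matrix.fromBlocks_apply₁₁, Matrix.fromBlocks_apply₁₂, Matrix.fromBlocks_apply₂₁,
        Matrix.fromBlocks_apply₂₂, h1, h2]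
  rw [← Matrix.det_submatrix_equiv_self e, hblock]
  have : Invertible (Aᵀ * A) := Matrix.invertibleOfIsUnitDet _ hAu
  rw [Matrix.det_fromBlocks₁₁, Matrix.invOf_eq_nonsing_inv]
  congr 1
  have : Bᵀ * B - Bᵀ * A * (Aᵀ * A)⁻¹ * (Aᵀ * B) = Bᵀ * (H * B) := by
    simp only [H, G, Matrix.sub_mul, Matrix.mul_sub, Matrix.one_mul, Matrix.mul_assoc]
  rw [this, Matrix.det_unique]
  rfl

lemma lmarg_super {m : ℕ} {X : Type*} [MeasurableSpace X] (μ : Measure X) [SigmaFinite μ]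
    (w : X → X → ℝ≥0∞) (hw : ∀ x, Measurable (w x)) (F : (Fin m → X) → ℝ≥0∞) (hF : Measurable F)
    (h : ∀ x j, ∫⁻ y, w (x j) y * F (Function.update x j y) ∂μ ≤ F x) (x : Fin m → X) :
    ∫⁻ y, (∏ j, w (x j) (y j)) * F y ∂(Measure.pi fun _ => μ) ≤ F x := by
  have main : ∀ s : Finset (Fin m), ∀ z : Fin m → X, (∀ j ∈ s, z j = x j) →
      (∫⋯∫⁻_s, (fun y => (∏ j ∈ s, w (x j) (y j)) * F y) ∂(fun _ => μ)) z ≤ F z := by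
    intro s
    induction s using Finset.induction_on with
    | empty => intro z _; simp
    | insert i s hi ih =>
      intro z hz
      have hmeas : ∀ s : Finset (Fin m),
          Measurable (fun y : Fin m → X => (∏ j ∈ s, w (x j) (y j)) * F y) := fun s =>
        (Finset.measurable_prod _ fun j _ => (hw (x j)).comp (measurable_pi_apply j)).mul hF
      rw [lmarginal_insert _ (hmeas _) hi]
      refine le_trans (lintegral_mono fun y => ?_) (h z i)
      rw [hz i (Finset.mem_insert_self i s)]
      have e : (∫⋯∫⁻_s, (fun y => (∏ j ∈ insert i s, w (x j) (y j)) * F y) ∂(fun _ => μ))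
          (Function.update z i y) =
          w (x i) y * (∫⋯∫⁻_s, (fun y => (∏ j ∈ s, w (x j) (y j)) * F y) ∂(fun _ => μ))
            (Function.update z i y) := by
        unfold lmarginal
        rw [← lintegral_const_mul]
        · refine lintegral_congr fun u => ?_
          beta_reduce
          rw [Finset.prod_insert hi, mul_assoc]
          congr 2
          simp [Function.updateFinset, hi]
        · exact (hmeas s).comp measurable_updateFinset
      rw [e]
      gcongr
      refine ih _ fun j hj => ?_
      rw [Function.update_of_ne (by rintro rfl; exact hi hj)]
      exact hz j (Finset.mem_insert_of_mem hj)
  rw [lintegral_eq_lmarginal_univ x]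
  exact main Finset.univ x fun _ _ => rfl

def colMap (n m : ℕ) (x : Fin m → Fin n → ℝ) : EuclideanSpace ℝ (Fin n × Fin m) :=
  WithLp.toLp 2 (fun p => x p.2 p.1)

lemma colMap_mp (n m : ℕ) : MeasurePreserving (colMap n m) volume volume := by
  have h1 : MeasurePreserving (fun (x : Fin m → Fin n → ℝ) (p : Fin n × Fin m) => x p.2 p.1)
      volume volume := by
    have hmeas : Measurable (fun (x : Fin m → Fin n → ℝ) (p : Fin n × Fin m) => x p.2 p.1) := by
      fun_prop
    refine ⟨hmeas, ?_⟩
    symm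
    refine Measure.pi_eq fun s hs => ?_
    rw [Measure.map_apply hmeas (MeasurableSet.univ_pi hs)]
    have : (fun (x : Fin m → Fin n → ℝ) (p : Fin n × Fin m) => x p.2 p.1) ⁻¹' Set.univ.pi s =
        Set.univ.pi (fun j => Set.univ.pi (fun i => s (i, j))) := by
      ext x
      simp only [Set.mem_preimage, Set.mem_pi, Set.mem_univ, true_imp_iff, Prod.forall]
      exact forall_comm
    rw [this, volume_pi_pi]
    simp_rw [volume_pi_pi]
    rw [Fintype.prod_prod_type_right]
  exact (PiLp.volume_preserving_toLp (Fin n × Fin m)).comp h1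

lemma gram_posSemidef {n m : ℕ} (A : Matrix (Fin n) (Fin m) ℝ) : (Aᵀ * A).PosSemidef := by
  have := Matrix.posSemidef_conjTranspose_mul_self A
  rwa [Matrix.conjTranspose_eq_transpose_of_trivial] at this

lemma newtonN_zero (β : ℝ) : newtonN β 0 = ⊤ := by
  by_contra hne
  apply not_integrableOn_Ioi_rpow (β - 1)
  refine ⟨by fun_prop, ?_⟩
  rw [hasFiniteIntegral_iff_ofReal]
  · have : newtonN β 0 = ∫⁻ s in Set.Ioi (0 : ℝ), ENNReal.ofReal (s ^ (β - 1)) := by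
      simp [newtonN]
    rw [← this]
    exact lt_top_iff_ne_top.2 hne
  · refine (ae_restrict_iff' measurableSet_Ioi).2 (Filter.Eventually.of_forall fun s hs => ?_)
    exact Real.rpow_nonneg (le_of_lt hs) _

lemma newtonN_pos (β q : ℝ) (hβ : 0 < β) (hq : 0 < q) :
    newtonN β q = ENNReal.ofReal (q ^ (-β) * Real.Gamma β) := by
  have h := Real.integral_rpow_mul_exp_neg_mul_Ioi hβ hq
  have e : q ^ (-β) * Real.Gamma β =
      ∫ s in Set.Ioi (0 : ℝ), s ^ (β - 1) * Real.exp (-(s * q)) := by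
    simp_rw [mul_comm _ q]
    rw [h, one_div, Real.inv_rpow hq.le, Real.rpow_neg hq.le]
  rw [e, ofReal_integral_eq_lintegral_ofReal]
  · rfl
  · by_contra hne
    have h0 := integral_undef hne
    rw [← e] at h0
    have : 0 < q ^ (-β) * Real.Gamma β := by
      have := Real.Gamma_pos_of_pos hβ
      positivity
    linarith
  · refine (ae_restrict_iff' measurableSet_Ioi).2 (Filter.Eventually.of_forall fun s hs => ?_)
    exact mul_nonneg (Real.rpow_nonneg (le_of_lt hs) _) (Real.exp_nonneg _)

lemma piSVS_eq (n m : ℕ) (hnm : m + 2 ≤ n) (x : EuclideanSpace ℝ (Fin n × Fin m)) :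
    piSVS n m x = ENNReal.ofReal ((Real.Gamma (((n : ℝ) - m - 1) / 2))⁻¹) *
      newtonN (((n : ℝ) - m - 1) / 2) (((toMat x)ᵀ * toMat x).det) := by
  have hβ : 0 < ((n : ℝ) - m - 1) / 2 := by
    have : (m : ℝ) + 2 ≤ n := by exact_mod_cast hnm
    linarith
  have hΓ := Real.Gamma_pos_of_pos hβ
  have hd := (gram_posSemidef (toMat x)).det_nonneg
  unfold piSVS
  split_ifs with h
  · have hd' : 0 < ((toMat x)ᵀ * toMat x).det := lt_of_le_of_ne hd (Ne.symm h.ne_zero)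
    rw [newtonN_pos _ _ hβ hd', ← ENNReal.ofReal_mul (by positivity)]
    congr 1
    field_simp
  · have hd' : ((toMat x)ᵀ * toMat x).det = 0 := by
      by_contra h'
      exact h (Ne.isUnit h')
    rw [hd', newtonN_zero, ENNReal.mul_top]
    simpa using hΓ

lemma det_measurable (n m : ℕ) :
    Measurable (fun x : EuclideanSpace ℝ (Fin n × Fin m) => ((toMat x)ᵀ * toMat x).det) := by
  have : Continuous (fun x : EuclideanSpace ℝ (Fin n × Fin m) => ((toMat x)ᵀ * toMat x).det) := by
    have h : Continuous (fun x : EuclideanSpace ℝ (Fin n × Fin m) => toMat x) := by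
      refine continuous_matrix fun i j => ?_
      unfold toMat
      fun_prop
    exact (h.matrix_transpose.matrix_mul h).matrix_det
  exact this.measurable

lemma piSVS_measurable (n m : ℕ) (hnm : m + 2 ≤ n) : Measurable (piSVS n m) := by
  rw [funext (piSVS_eq n m hnm)]
  exact ((newtonN_measurable _).comp (det_measurable n m)).const_mul _

lemma pdens_measurable (n m : ℕ) (v : ℝ) :
    Measurable (fun p : EuclideanSpace ℝ (Fin n × Fin m) × EuclideanSpace ℝ (Fin n × Fin m) =>
      pdens n m v p.1 p.2) := by
  unfold pdens
  fun_prop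

lemma toMat_colMap_update {n m : ℕ} (x : Fin m → Fin n → ℝ) (j : Fin m) (y : Fin n → ℝ) :
    toMat (colMap n m (Function.update x j y)) = (toMat (colMap n m x)).updateCol j y := by
  ext i k
  by_cases h : k = j
  · subst h
    simp [toMat, colMap]
  · simp [toMat, colMap, h]

lemma pdens_colMap {n m : ℕ} (v : ℝ) (hv : 0 < v) (x y : Fin m → Fin n → ℝ) :
    pdens n m v (colMap n m x) (colMap n m y) =
      ∏ j, ((√(2 * Real.pi * v))⁻¹ ^ Fintype.card (Fin n) *
        Real.exp (-‖(WithLp.toLp 2 (x j) : EuclideanSpace ℝ (Fin n)) - WithLp.toLp 2 (y j)‖ ^ 2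
          / (2 * v))) := by
  rw [Finset.prod_mul_distrib, ← Real.exp_sum]
  unfold pdens
  have hp : 0 < 2 * Real.pi * v := by positivity
  congr 1
  · rw [Finset.prod_const, Real.sqrt_eq_rpow, ← Real.rpow_neg hp.le, ← Real.rpow_natCast,
      ← Real.rpow_natCast, ← Real.rpow_mul hp.le, ← Real.rpow_mul hp.le]
    congr 1
    simp
    ring
  · congr 1
    rw [← Finset.sum_div, Finset.sum_neg_distrib]
    congr 2
    simp_rw [EuclideanSpace.norm_sq_eq]
    rw [Fintype.sum_prod_type_right]
    simp [colMap]

lemma key_super (n m : ℕ) (hnm : m + 2 ≤ n) (v : ℝ) (hv : 0 < v)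
    (Z : EuclideanSpace ℝ (Fin n × Fin m)) :
    marg n m (piSVS n m) v Z ≤ piSVS n m Z := by
  obtain ⟨x, rfl⟩ : ∃ x, Z = colMap n m x := ⟨fun j i => Z (i, j), by ext p; rfl⟩
  have hπ := piSVS_measurable n m hnm
  unfold marg
  have hmeas : Measurable (fun M => ENNReal.ofReal (pdens n m v (colMap n m x) M) * piSVS n m M) :=
    (ENNReal.measurable_ofReal.comp ((pdens_measurable n m v).comp
      (measurable_const.prodMk measurable_id))).mul hπ
  rw [← (colMap_mp n m).lintegral_comp hmeas]
  simp_rw [pdens_colMap v hv]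
  simp_rw [fun y : Fin m → Fin n → ℝ => ENNReal.ofReal_prod_of_nonneg
    (s := Finset.univ) (f := fun j => ((√(2 * Real.pi * v))⁻¹ ^ Fintype.card (Fin n) *
        Real.exp (-‖(WithLp.toLp 2 (x j) : EuclideanSpace ℝ (Fin n)) - WithLp.toLp 2 (y j)‖ ^ 2
          / (2 * v)))) (fun j _ => by positivity)]
  refine lmarg_super (volume : Measure (Fin n → ℝ)) (fun a b => ENNReal.ofReal
    ((√(2 * Real.pi * v))⁻¹ ^ Fintype.card (Fin n) *
        Real.exp (-‖(WithLp.toLp 2 a : EuclideanSpace ℝ (Fin n)) - WithLp.toLp 2 b‖ ^ 2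
          / (2 * v)))) ?_ (fun y => piSVS n m (colMap n m y))
    (hπ.comp (colMap_mp n m).measurable) ?_ x
  · intro a
    fun_prop
  · intro x j
    simp only
    by_cases hdet : ((toMat (colMap n m x))ᵀ * toMat (colMap n m x)).det = 0
    · have : piSVS n m (colMap n m x) = ⊤ := by
        unfold piSVS
        rw [if_neg]
        rw [hdet]
        simp
      rw [this]
      exact le_top
    obtain ⟨b, l, c, hc, hl, hsum, hq⟩ := gram_update _ hdet j
    have hself : (toMat (colMap n m x)).updateCol j (x j) = toMat (colMap n m x) := by
      rw [← toMat_colMap_update, Function.update_eq_self]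
    have hqx := hq (x j)
    rw [hself] at hqx
    have hns := newton_super b v c (((n : ℝ) - m - 1) / 2) hv hc.le l hl
      (by rw [hsum]; ring) (WithLp.toLp 2 (x j))
    rw [piSVS_eq n m hnm, hqx]
    simp_rw [piSVS_eq n m hnm, toMat_colMap_update, hq]
    rw [← (PiLp.volume_preserving_toLp (Fin n)).lintegral_comp_emb
      (MeasurableEquiv.toLp 2 (Fin n → ℝ)).measurableEmbedding] at hns
    calc _ = ENNReal.ofReal ((Real.Gamma (((n : ℝ) - m - 1) / 2))⁻¹) *
        ∫⁻ y : Fin n → ℝ, ENNReal.ofReal ((√(2 * Real.pi * v))⁻¹ ^ Fintype.card (Fin n) *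
        Real.exp (-‖(WithLp.toLp 2 (x j) : EuclideanSpace ℝ (Fin n)) - WithLp.toLp 2 y‖ ^ 2
          / (2 * v))) * newtonN (((n : ℝ) - m - 1) / 2)
            (c * ∑ i, l i * (b.repr (WithLp.toLp 2 y) i) ^ 2) := by
          rw [← lintegral_const_mul' _ _ ENNReal.ofReal_ne_top]
          refine lintegral_congr fun y => ?_
          ring
      _ ≤ _ := by
          gcongr

lemma pdens_pos (n m : ℕ) {v : ℝ} (hv : 0 < v) (X M : EuclideanSpace ℝ (Fin n × Fin m)) :
    0 < pdens n m v X M := by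
  unfold pdens
  have : 0 < 2 * Real.pi * v := by positivity
  positivity

lemma pdens_symm (n m : ℕ) (v : ℝ) (X M : EuclideanSpace ℝ (Fin n × Fin m)) :
    pdens n m v X M = pdens n m v M X := by
  unfold pdens
  rw [norm_sub_rev]

lemma pdens_integrable_zero (n m : ℕ) {v : ℝ} (hv : 0 < v) :
    Integrable (fun X : EuclideanSpace ℝ (Fin n × Fin m) => pdens n m v X 0) ∧
    ∫ X : EuclideanSpace ℝ (Fin n × Fin m), pdens n m v X 0 = 1 := by
  have hb : 0 < 1 / (2 * v) := by positivity
  have h := GaussianFourier.integral_rexp_neg_mul_sq_norm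
    (V := EuclideanSpace ℝ (Fin n × Fin m)) hb
  have e : ∀ X : EuclideanSpace ℝ (Fin n × Fin m), pdens n m v X 0 =
      (2 * Real.pi * v) ^ (-((n : ℝ) * m) / 2) * Real.exp (-(1 / (2 * v)) * ‖X‖ ^ 2) := by
    intro X
    unfold pdens
    rw [sub_zero]
    congr 2
    ring
  have hp : 0 < 2 * Real.pi * v := by positivity
  have hfin : (Module.finrank ℝ (EuclideanSpace ℝ (Fin n × Fin m)) : ℝ) = n * m := by
    simp
  rw [hfin, show Real.pi / (1 / (2 * v)) = 2 * Real.pi * v by field_simp] at h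
  simp_rw [e]
  constructor
  · refine Integrable.const_mul ?_ _
    by_contra hne
    rw [integral_undef hne] at h
    have : 0 < (2 * Real.pi * v) ^ ((n : ℝ) * m / 2) := by positivity
    linarith
  · rw [integral_const_mul, h, ← Real.rpow_add hp]
    have : -((n : ℝ) * m) / 2 + n * m / 2 = 0 := by ring
    rw [this, Real.rpow_zero]

lemma pdens_sub (n m : ℕ) (v : ℝ) (X M : EuclideanSpace ℝ (Fin n × Fin m)) :
    pdens n m v X M = pdens n m v (X - M) 0 := by
  unfold pdens
  rw [sub_zero]

lemma pdens_integrable (n m : ℕ) {v : ℝ} (hv : 0 < v) (M : EuclideanSpace ℝ (Fin n × Fin m)) :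
    Integrable (fun X : EuclideanSpace ℝ (Fin n × Fin m) => pdens n m v X M) := by
  simp_rw [fun X => pdens_sub n m v X M]
  exact (pdens_integrable_zero n m hv).1.comp_sub_right M

lemma pdens_integral (n m : ℕ) {v : ℝ} (hv : 0 < v) (M : EuclideanSpace ℝ (Fin n × Fin m)) :
    ∫ X : EuclideanSpace ℝ (Fin n × Fin m), pdens n m v X M = 1 := by
  simp_rw [fun X => pdens_sub n m v X M]
  rw [integral_sub_right_eq_self (fun X => pdens n m v X 0)]
  exact (pdens_integrable_zero n m hv).2

lemma pdens_lintegral (n m : ℕ) {v : ℝ} (hv : 0 < v) (M : EuclideanSpace ℝ (Fin n × Fin m)) :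
    ∫⁻ X : EuclideanSpace ℝ (Fin n × Fin m), ENNReal.ofReal (pdens n m v X M) = 1 := by
  rw [← ofReal_integral_eq_lintegral_ofReal (pdens_integrable n m hv M)
    (Filter.Eventually.of_forall fun X => (pdens_pos n m hv X M).le), pdens_integral n m hv]
  simp

lemma pdens_lintegral' (n m : ℕ) {v : ℝ} (hv : 0 < v) (M : EuclideanSpace ℝ (Fin n × Fin m)) :
    ∫⁻ X : EuclideanSpace ℝ (Fin n × Fin m), ENNReal.ofReal (pdens n m v M X) = 1 := by
  simp_rw [fun X => pdens_symm n m v M X]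
  exact pdens_lintegral n m hv M

lemma pdens_mul (n m : ℕ) {s t : ℝ} (hs : 0 < s) (ht : 0 < t)
    (X Y M : EuclideanSpace ℝ (Fin n × Fin m)) :
    pdens n m s X M * pdens n m t Y M = pdens n m (s + t) X Y *
      pdens n m (s * t / (s + t)) ((t / (s + t)) • X + (s / (s + t)) • Y) M := by
  have hst : 0 < s + t := by positivity
  have hpi := Real.pi_pos
  unfold pdens
  have e1 : (2 * Real.pi * s) ^ (-((n : ℝ) * m) / 2) * (2 * Real.pi * t) ^ (-((n : ℝ) * m) / 2) =
      (2 * Real.pi * (s + t)) ^ (-((n : ℝ) * m) / 2) *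
        (2 * Real.pi * (s * t / (s + t))) ^ (-((n : ℝ) * m) / 2) := by
    rw [← Real.mul_rpow (by positivity) (by positivity),
      ← Real.mul_rpow (by positivity) (by positivity)]
    congr 1
    field_simp
  have e2 : -‖X - M‖ ^ 2 / (2 * s) + -‖Y - M‖ ^ 2 / (2 * t) =
      -‖X - Y‖ ^ 2 / (2 * (s + t)) +
        -‖(t / (s + t)) • X + (s / (s + t)) • Y - M‖ ^ 2 / (2 * (s * t / (s + t))) := by
    have h1 : X - Y = (X - M) - (Y - M) := by abel
    have h2 : (t / (s + t)) • X + (s / (s + t)) • Y - M =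
        (t / (s + t)) • (X - M) + (s / (s + t)) • (Y - M) := by
      have h3 : (t / (s + t)) • M + (s / (s + t)) • M = M := by
        rw [← add_smul, ← add_div, add_comm t s, div_self hst.ne', one_smul]
      rw [smul_sub, smul_sub]
      nth_rewrite 1 [← h3]
      abel
    rw [h1, h2]
    generalize X - M = a
    generalize Y - M = b
    rw [norm_sub_sq_real, norm_add_sq_real, norm_smul, norm_smul, inner_smul_left,
      inner_smul_right, mul_pow, mul_pow, Real.norm_eq_abs, Real.norm_eq_abs, sq_abs, sq_abs]
    simp only [conj_trivial]
    field_simp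
    ring
  calc _ = ((2 * Real.pi * s) ^ (-((n : ℝ) * m) / 2) * (2 * Real.pi * t) ^ (-((n : ℝ) * m) / 2)) *
        Real.exp (-‖X - M‖ ^ 2 / (2 * s) + -‖Y - M‖ ^ 2 / (2 * t)) := by
        rw [Real.exp_add]; ring
    _ = _ := by rw [e1, e2, Real.exp_add]; ring

lemma pdens_meas_left (n m : ℕ) (v : ℝ) (M : EuclideanSpace ℝ (Fin n × Fin m)) :
    Measurable (fun X => ENNReal.ofReal (pdens n m v X M)) := by
  unfold pdens
  fun_prop

lemma pdens_meas_right (n m : ℕ) (v : ℝ) (X : EuclideanSpace ℝ (Fin n × Fin m)) :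
    Measurable (fun M => ENNReal.ofReal (pdens n m v X M)) := by
  unfold pdens
  fun_prop

lemma marg_measurable (n m : ℕ) (v : ℝ) (f : EuclideanSpace ℝ (Fin n × Fin m) → ℝ≥0∞)
    (hf : Measurable f) : Measurable (marg n m f v) := by
  unfold marg
  refine Measurable.lintegral_prod_right' (f := fun p : EuclideanSpace ℝ (Fin n × Fin m) ×
    EuclideanSpace ℝ (Fin n × Fin m) => ENNReal.ofReal (pdens n m v p.1 p.2) * f p.2) ?_
  exact (ENNReal.measurable_ofReal.comp (pdens_measurable n m v)).mul (hf.comp measurable_snd)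

lemma marg_semigroup (n m : ℕ) {s t : ℝ} (hs : 0 < s) (ht : 0 < t)
    (f : EuclideanSpace ℝ (Fin n × Fin m) → ℝ≥0∞) (hf : Measurable f)
    (Z : EuclideanSpace ℝ (Fin n × Fin m)) :
    marg n m (marg n m f t) s Z = marg n m f (s + t) Z := by
  unfold marg
  calc _ = ∫⁻ X : EuclideanSpace ℝ (Fin n × Fin m), ∫⁻ M : EuclideanSpace ℝ (Fin n × Fin m),
        ENNReal.ofReal (pdens n m s Z X) * (ENNReal.ofReal (pdens n m t X M) * f M) := by
        refine lintegral_congr fun X => ?_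
        rw [lintegral_const_mul' _ _ ENNReal.ofReal_ne_top]
    _ = ∫⁻ M : EuclideanSpace ℝ (Fin n × Fin m), ∫⁻ X : EuclideanSpace ℝ (Fin n × Fin m),
        ENNReal.ofReal (pdens n m s Z X) * (ENNReal.ofReal (pdens n m t X M) * f M) := by
        refine lintegral_lintegral_swap (Measurable.aemeasurable ?_)
        have h1 : Measurable (fun p : EuclideanSpace ℝ (Fin n × Fin m) ×
            EuclideanSpace ℝ (Fin n × Fin m) => ENNReal.ofReal (pdens n m s Z p.1)) :=
          (pdens_meas_right n m s Z).comp measurable_fst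
        have h2 : Measurable (fun p : EuclideanSpace ℝ (Fin n × Fin m) ×
            EuclideanSpace ℝ (Fin n × Fin m) => ENNReal.ofReal (pdens n m t p.1 p.2)) :=
          ENNReal.measurable_ofReal.comp (pdens_measurable n m t)
        exact h1.mul (h2.mul (hf.comp measurable_snd))
    _ = _ := by
        refine lintegral_congr fun M => ?_
        have e : ∀ X, ENNReal.ofReal (pdens n m s Z X) *
            (ENNReal.ofReal (pdens n m t X M) * f M) =
            (ENNReal.ofReal (pdens n m (s + t) Z M) * f M) * ENNReal.ofReal
              (pdens n m (s * t / (s + t)) ((t / (s + t)) • Z + (s / (s + t)) • M) X) := by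
          intro X
          rw [pdens_symm n m t X M, ← mul_assoc, ← ENNReal.ofReal_mul (pdens_pos n m hs _ _).le,
            pdens_mul n m hs ht, ENNReal.ofReal_mul (pdens_pos n m (by positivity) _ _).le]
          ring
        simp_rw [e]
        rw [lintegral_const_mul _ (pdens_meas_right n m _ _), pdens_lintegral' n m (by positivity),
          mul_one]

lemma marg_antitone (n m : ℕ) (hnm : m + 2 ≤ n) {s t : ℝ} (hs : 0 < s) (ht : 0 < t)
    (Z : EuclideanSpace ℝ (Fin n × Fin m)) :
    marg n m (piSVS n m) (s + t) Z ≤ marg n m (piSVS n m) s Z := by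
  rw [← marg_semigroup n m hs ht _ (piSVS_measurable n m hnm)]
  unfold marg
  refine lintegral_mono fun X => ?_
  dsimp only
  gcongr
  exact key_super n m hnm t ht X

lemma pdens_compare (n m : ℕ) {v : ℝ} (hv : 0 < v) (Z N M : EuclideanSpace ℝ (Fin n × Fin m)) :
    pdens n m v Z M ≤ ((2 : ℝ) ^ ((n : ℝ) * m / 2) * Real.exp (‖Z - N‖ ^ 2 / (2 * v))) *
      pdens n m (2 * v) N M := by
  unfold pdens
  have hp : 0 < 2 * Real.pi * v := by positivity
  have e1 : (2 * Real.pi * v) ^ (-((n : ℝ) * m) / 2) = (2 : ℝ) ^ ((n : ℝ) * m / 2) *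
      (2 * Real.pi * (2 * v)) ^ (-((n : ℝ) * m) / 2) := by
    rw [show 2 * Real.pi * (2 * v) = 2 * (2 * Real.pi * v) by ring,
      Real.mul_rpow (by positivity) hp.le, ← mul_assoc, ← Real.rpow_add (by positivity),
      show (n : ℝ) * m / 2 + -((n : ℝ) * m) / 2 = 0 by ring, Real.rpow_zero, one_mul]
  have e2 : Real.exp (-‖Z - M‖ ^ 2 / (2 * v)) ≤ Real.exp (‖Z - N‖ ^ 2 / (2 * v)) *
      Real.exp (-‖N - M‖ ^ 2 / (2 * (2 * v))) := by
    rw [← Real.exp_add, Real.exp_le_exp]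
    have h : ‖N - M‖ ^ 2 ≤ 2 * ‖Z - N‖ ^ 2 + 2 * ‖Z - M‖ ^ 2 := by
      have h1 : ‖N - M‖ ≤ ‖Z - N‖ + ‖Z - M‖ := by
        have : N - M = (Z - M) - (Z - N) := by abel
        rw [this, add_comm]
        exact norm_sub_le _ _
      have h2 : ‖N - M‖ ^ 2 ≤ (‖Z - N‖ + ‖Z - M‖) ^ 2 := by gcongr
      nlinarith [sq_nonneg (‖Z - N‖ - ‖Z - M‖)]
    have h3 : ‖Z - N‖ ^ 2 / (2 * v) + -‖N - M‖ ^ 2 / (2 * (2 * v)) - -‖Z - M‖ ^ 2 / (2 * v) =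
        (2 * ‖Z - N‖ ^ 2 + 2 * ‖Z - M‖ ^ 2 - ‖N - M‖ ^ 2) / (4 * v) := by
      field_simp
      ring
    have h4 : 0 ≤ (2 * ‖Z - N‖ ^ 2 + 2 * ‖Z - M‖ ^ 2 - ‖N - M‖ ^ 2) / (4 * v) :=
      div_nonneg (by linarith) (by positivity)
    linarith
  rw [e1]
  calc _ ≤ (2 : ℝ) ^ ((n : ℝ) * m / 2) * (2 * Real.pi * (2 * v)) ^ (-((n : ℝ) * m) / 2) *
        (Real.exp (‖Z - N‖ ^ 2 / (2 * v)) * Real.exp (-‖N - M‖ ^ 2 / (2 * (2 * v)))) := by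
        gcongr
    _ = _ := by ring

lemma marg_compare (n m : ℕ) {v : ℝ} (hv : 0 < v) (f : EuclideanSpace ℝ (Fin n × Fin m) → ℝ≥0∞)
    (Z N : EuclideanSpace ℝ (Fin n × Fin m)) :
    marg n m f v Z ≤ ENNReal.ofReal ((2 : ℝ) ^ ((n : ℝ) * m / 2) *
      Real.exp (‖Z - N‖ ^ 2 / (2 * v))) * marg n m f (2 * v) N := by
  unfold marg
  rw [← lintegral_const_mul' _ _ ENNReal.ofReal_ne_top]
  refine lintegral_mono fun M => ?_
  dsimp only
  rw [← mul_assoc, ← ENNReal.ofReal_mul (by positivity)]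
  gcongr
  exact pdens_compare n m hv Z N M

lemma piSVS_pos (n m : ℕ) (x : EuclideanSpace ℝ (Fin n × Fin m)) : 0 < piSVS n m x := by
  unfold piSVS
  split_ifs with h
  · have hd' : 0 < ((toMat x)ᵀ * toMat x).det :=
      lt_of_le_of_ne (gram_posSemidef (toMat x)).det_nonneg (Ne.symm h.ne_zero)
    rw [ENNReal.ofReal_pos]
    positivity
  · exact ENNReal.zero_lt_top

lemma exists_finite (n m : ℕ) (hnm : m + 2 ≤ n) :
    ∃ x : EuclideanSpace ℝ (Fin n × Fin m), piSVS n m x ≠ ⊤ := by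
  refine ⟨WithLp.toLp 2 (fun p => if p.1 = Fin.castLE (by omega) p.2 then 1 else 0), ?_⟩
  unfold piSVS
  rw [if_pos]
  · exact ENNReal.ofReal_ne_top
  · have hmn : m ≤ n := by omega
    have h1 : toMat (WithLp.toLp 2 (fun p : Fin n × Fin m =>
        if p.1 = Fin.castLE hmn p.2 then (1 : ℝ) else 0)) =
        Matrix.of (fun i a => if i = Fin.castLE hmn a then (1 : ℝ) else 0) := rfl
    have h2 : (Matrix.of (fun i a => if i = Fin.castLE hmn a then (1 : ℝ) else 0))ᵀ *
        Matrix.of (fun i a => if i = Fin.castLE hmn a then (1 : ℝ) else 0) = 1 := by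
      ext a b
      simp [Matrix.mul_apply, Matrix.one_apply]
      simp only [eq_comm]
    rw [h1, h2]
    simp

lemma marg_ne_top (n m : ℕ) (hnm : m + 2 ≤ n) {v : ℝ} (hv : 0 < v)
    (Z : EuclideanSpace ℝ (Fin n × Fin m)) : marg n m (piSVS n m) v Z ≠ ⊤ := by
  obtain ⟨N, hN⟩ := exists_finite n m hnm
  refine ne_top_of_le_ne_top ?_ (marg_compare n m hv _ Z N)
  exact ENNReal.mul_ne_top ENNReal.ofReal_ne_top
    (ne_top_of_le_ne_top hN (key_super n m hnm _ (by positivity) N))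

lemma marg_pos (n m : ℕ) (hnm : m + 2 ≤ n) {v : ℝ} (hv : 0 < v)
    (Z : EuclideanSpace ℝ (Fin n × Fin m)) : 0 < marg n m (piSVS n m) v Z := by
  unfold marg
  have hmeas : Measurable (fun M => ENNReal.ofReal (pdens n m v Z M) * piSVS n m M) :=
    (pdens_meas_right n m v Z).mul (piSVS_measurable n m hnm)
  rw [lintegral_pos_iff_support hmeas]
  have : Function.support (fun M => ENNReal.ofReal (pdens n m v Z M) * piSVS n m M) = Set.univ := by
    ext M
    simp only [Function.mem_support, Set.mem_univ, iff_true]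
    exact mul_ne_zero (ENNReal.ofReal_pos.2 (pdens_pos n m hv Z M)).ne' (piSVS_pos n m M).ne'
  rw [this]
  exact Measure.measure_univ_pos.2 (NeZero.ne _)

lemma lintegral_affine (n m : ℕ) {r : ℝ} (hr : 0 < r) (c : EuclideanSpace ℝ (Fin n × Fin m))
    (f : EuclideanSpace ℝ (Fin n × Fin m) → ℝ≥0∞) (hf : Measurable f) :
    ∫⁻ x, f (r • x + c) = ENNReal.ofReal ((r ^ (n * m))⁻¹) * ∫⁻ x, f x := by
  have h := Measure.map_addHaar_smul (volume : Measure (EuclideanSpace ℝ (Fin n × Fin m))) hr.ne'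
  have h1 : ∫⁻ x, f (r • x + c) = ∫⁻ x, f (x + c) ∂(Measure.map (fun x => r • x) volume) := by
    have hf' : Measurable (fun x => f (x + c)) := hf.comp (measurable_add_const c)
    rw [lintegral_map hf' (measurable_const_smul r)]
  rw [h1, h, lintegral_smul_measure, lintegral_add_right_eq_self f c, abs_of_nonneg (by positivity)]
  simp

lemma pdens_scale (n m : ℕ) {v r : ℝ} (hv : 0 < v) (hr : 0 < r)
    (W Y X N : EuclideanSpace ℝ (Fin n × Fin m)) (h : W - Y = r • (X - N)) :
    pdens n m v X N = r ^ (n * m) * pdens n m (r ^ 2 * v) W Y := by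
  unfold pdens
  rw [h, norm_smul, mul_pow, Real.norm_eq_abs, sq_abs]
  have hp : 0 < 2 * Real.pi * v := by positivity
  have e1 : (2 * Real.pi * (r ^ 2 * v)) ^ (-((n : ℝ) * m) / 2) =
      (r ^ (n * m))⁻¹ * (2 * Real.pi * v) ^ (-((n : ℝ) * m) / 2) := by
    rw [show 2 * Real.pi * (r ^ 2 * v) = r ^ 2 * (2 * Real.pi * v) by ring,
      Real.mul_rpow (by positivity) hp.le, ← Real.rpow_natCast r 2, ← Real.rpow_mul hr.le,
      ← Real.rpow_natCast r (n * m), ← Real.rpow_neg hr.le]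
    congr 2
    push_cast
    ring
  have e2 : -(r ^ 2 * ‖X - N‖ ^ 2) / (2 * (r ^ 2 * v)) = -‖X - N‖ ^ 2 / (2 * v) := by
    field_simp
  rw [e1, e2]
  have : r ^ (n * m) ≠ 0 := by positivity
  field_simp

lemma piSVS_smul (n m : ℕ) {r : ℝ} (hr : 0 < r) (x : EuclideanSpace ℝ (Fin n × Fin m)) :
    piSVS n m (r • x) = ENNReal.ofReal (r ^ (-((n : ℝ) - m - 1) * m)) * piSVS n m x := by
  have h1 : toMat (r • x) = r • toMat x := by
    ext i j
    simp [toMat]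
  have h2 : ((toMat (r • x))ᵀ * toMat (r • x)).det =
      (r ^ 2) ^ m * ((toMat x)ᵀ * toMat x).det := by
    rw [h1, Matrix.transpose_smul, Matrix.smul_mul, Matrix.mul_smul, smul_smul, Matrix.det_smul,
      Fintype.card_fin, pow_two]
  have hr2 : 0 < (r ^ 2) ^ m := by positivity
  unfold piSVS
  rw [h2]
  by_cases h : IsUnit ((toMat x)ᵀ * toMat x).det
  · rw [if_pos h, if_pos ((hr2.ne'.isUnit).mul h), ← ENNReal.ofReal_mul (by positivity),
      Real.mul_rpow hr2.le (gram_posSemidef (toMat x)).det_nonneg]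
    congr 2
    rw [← pow_mul, ← Real.rpow_natCast, ← Real.rpow_mul hr.le]
    congr 1
    push_cast
    ring
  · rw [if_neg h, if_neg, ENNReal.mul_top]
    · have := Real.rpow_pos_of_pos hr (-((n : ℝ) - m - 1) * m)
      simpa using this
    · intro h'
      exact h (isUnit_of_mul_isUnit_right h')

lemma marg_scale (n m : ℕ) (hnm : m + 2 ≤ n) {r : ℝ} (hr : 0 < r) :
    marg n m (piSVS n m) (r ^ 2) 0 =
      ENNReal.ofReal (r ^ (-((n : ℝ) - m - 1) * m)) * marg n m (piSVS n m) 1 0 := by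
  have hrd : 0 < r ^ (n * m) := by positivity
  unfold marg
  have h := lintegral_affine n m hr 0
    (fun M => ENNReal.ofReal (pdens n m (r ^ 2) 0 M) * piSVS n m M)
    ((pdens_meas_right n m _ 0).mul (piSVS_measurable n m hnm))
  have h' : ∫⁻ M, ENNReal.ofReal (pdens n m (r ^ 2) 0 M) * piSVS n m M =
      ENNReal.ofReal (r ^ (n * m)) * ∫⁻ M : EuclideanSpace ℝ (Fin n × Fin m),
        ENNReal.ofReal (pdens n m (r ^ 2) 0 (r • M + 0)) * piSVS n m (r • M + 0) := by
    rw [h, ← mul_assoc, ← ENNReal.ofReal_mul hrd.le, mul_inv_cancel₀ hrd.ne', ENNReal.ofReal_one,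
      one_mul]
  rw [h', ← lintegral_const_mul' _ _ ENNReal.ofReal_ne_top,
    ← lintegral_const_mul' _ _ ENNReal.ofReal_ne_top]
  refine lintegral_congr fun M => ?_
  rw [add_zero, piSVS_smul n m hr, ← mul_assoc, ← ENNReal.ofReal_mul hrd.le,
    pdens_scale n m one_pos hr 0 (r • M) 0 M (by simp), mul_one]
  ring

lemma marg_zero_strict (n m : ℕ) (hm : 1 ≤ m) (hnm : m + 2 ≤ n) {s t : ℝ} (hs : 0 < s)
    (hst : s < t) : marg n m (piSVS n m) t 0 ≠ marg n m (piSVS n m) s 0 := by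
  have ht : 0 < t := hs.trans hst
  intro h
  rw [← Real.sq_sqrt hs.le, ← Real.sq_sqrt ht.le, marg_scale n m hnm (Real.sqrt_pos.2 hs),
    marg_scale n m hnm (Real.sqrt_pos.2 ht)] at h
  have h1 := (ENNReal.mul_left_inj (marg_pos n m hnm one_pos 0).ne'
    (marg_ne_top n m hnm one_pos 0)).1 h
  rw [ENNReal.ofReal_eq_ofReal_iff (by positivity) (by positivity)] at h1
  have hneg : -((n : ℝ) - m - 1) * m < 0 := by
    have h2 : (m : ℝ) + 2 ≤ n := by exact_mod_cast hnm
    have h3 : (1 : ℝ) ≤ m := by exact_mod_cast hm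
    nlinarith
  have := Real.rpow_lt_rpow_of_neg (Real.sqrt_pos.2 hs) (Real.sqrt_lt_sqrt hs.le hst) hneg
  linarith

lemma ratio_identity (n m : ℕ) (hnm : m + 2 ≤ n) {v₁ v₂ : ℝ} (hv₁ : 0 < v₁) (hv₂ : 0 < v₂)
    (M : EuclideanSpace ℝ (Fin n × Fin m)) :
    ∫⁻ Y : EuclideanSpace ℝ (Fin n × Fin m), ∫⁻ Yt : EuclideanSpace ℝ (Fin n × Fin m),
      ENNReal.ofReal (pdens n m v₁ Y M * pdens n m v₂ Yt M) *
        (marg n m (piSVS n m) v₁ Y / marg n m (piSVS n m) (v₁ * v₂ / (v₁ + v₂))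
          ((v₂ / (v₁ + v₂)) • Y + (v₁ / (v₁ + v₂)) • Yt)) =
    ∫⁻ W : EuclideanSpace ℝ (Fin n × Fin m),
      ENNReal.ofReal (pdens n m (v₁ * v₂ / (v₁ + v₂)) W M) *
        (marg n m (piSVS n m) ((v₁ / (v₁ + v₂)) ^ 2 * (v₁ + v₂) + v₁) W /
          marg n m (piSVS n m) (v₁ * v₂ / (v₁ + v₂)) W) := by
  have hs : 0 < v₁ + v₂ := by positivity
  have ha : 0 < v₁ / (v₁ + v₂) := by positivity
  have hab : v₂ / (v₁ + v₂) = 1 - v₁ / (v₁ + v₂) := by field_simp; ring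
  set a := v₁ / (v₁ + v₂) with ha_def
  set b := v₂ / (v₁ + v₂) with hb_def
  set w := v₁ * v₂ / (v₁ + v₂) with hw_def
  have hw : 0 < w := by positivity
  set t := a ^ 2 * (v₁ + v₂) with ht_def
  have ht : 0 < t := by positivity
  have hpi := piSVS_measurable n m hnm
  have hm1 : Measurable (marg n m (piSVS n m) v₁) := marg_measurable n m v₁ _ hpi
  have hmw : Measurable (marg n m (piSVS n m) w) := marg_measurable n m w _ hpi
  have han : 0 < a ^ (n * m) := by positivity
  have step1 : ∀ Y : EuclideanSpace ℝ (Fin n × Fin m),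
      ∫⁻ Yt : EuclideanSpace ℝ (Fin n × Fin m),
      ENNReal.ofReal (pdens n m v₁ Y M * pdens n m v₂ Yt M) *
        (marg n m (piSVS n m) v₁ Y / marg n m (piSVS n m) w (b • Y + a • Yt)) =
      ∫⁻ W : EuclideanSpace ℝ (Fin n × Fin m), ENNReal.ofReal (pdens n m w W M) *
        (marg n m (piSVS n m) w W)⁻¹ *
        (ENNReal.ofReal (pdens n m t W Y) * marg n m (piSVS n m) v₁ Y) := by
    intro Y
    have hF : Measurable (fun W : EuclideanSpace ℝ (Fin n × Fin m) =>
        ENNReal.ofReal (pdens n m w W M) * (marg n m (piSVS n m) w W)⁻¹ *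
        (ENNReal.ofReal (pdens n m t W Y) * marg n m (piSVS n m) v₁ Y)) :=
      ((pdens_meas_left n m w M).mul hmw.inv).mul ((pdens_meas_left n m t Y).mul_const _)
    have h := lintegral_affine n m ha (b • Y) _ hF
    have h2 : ∀ Yt : EuclideanSpace ℝ (Fin n × Fin m),
        ENNReal.ofReal (pdens n m v₁ Y M * pdens n m v₂ Yt M) *
        (marg n m (piSVS n m) v₁ Y / marg n m (piSVS n m) w (b • Y + a • Yt)) =
        ENNReal.ofReal (a ^ (n * m)) *
        (ENNReal.ofReal (pdens n m w (a • Yt + b • Y) M) *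
          (marg n m (piSVS n m) w (a • Yt + b • Y))⁻¹ *
        (ENNReal.ofReal (pdens n m t (a • Yt + b • Y) Y) * marg n m (piSVS n m) v₁ Y)) := by
      intro Yt
      have e1 := pdens_mul n m hv₁ hv₂ Y Yt M
      rw [← ha_def, ← hb_def, ← hw_def] at e1
      have e2 := pdens_scale n m hs ha (a • Yt + b • Y) Y Yt Y (by
        rw [hab, smul_sub, sub_smul, one_smul]; abel)
      rw [← ht_def] at e2
      rw [e1, pdens_symm n m (v₁ + v₂) Y Yt, e2, add_comm (b • Y) (a • Yt),
        ENNReal.ofReal_mul (mul_nonneg han.le (pdens_pos n m ht _ _).le),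
        ENNReal.ofReal_mul han.le, div_eq_mul_inv]
      ring
    rw [lintegral_congr h2, lintegral_const_mul' _ _ ENNReal.ofReal_ne_top, h, ← mul_assoc,
      ← ENNReal.ofReal_mul han.le, mul_inv_cancel₀ han.ne', ENNReal.ofReal_one, one_mul]
  rw [lintegral_congr step1, lintegral_lintegral_swap]
  · refine lintegral_congr fun W => ?_
    have hG : Measurable (fun Y : EuclideanSpace ℝ (Fin n × Fin m) =>
        ENNReal.ofReal (pdens n m t W Y) * marg n m (piSVS n m) v₁ Y) :=
      (pdens_meas_right n m t W).mul hm1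
    rw [lintegral_const_mul _ hG]
    have h3 := marg_semigroup n m ht hv₁ _ hpi W
    have h4 : ∫⁻ Y : EuclideanSpace ℝ (Fin n × Fin m), ENNReal.ofReal (pdens n m t W Y) *
      marg n m (piSVS n m) v₁ Y = marg n m (piSVS n m) (t + v₁) W := h3
    rw [h4, div_eq_mul_inv]
    ring
  · have hp1 : Measurable (fun p : EuclideanSpace ℝ (Fin n × Fin m) ×
        EuclideanSpace ℝ (Fin n × Fin m) => ENNReal.ofReal (pdens n m w p.2 M)) :=
      (pdens_meas_left n m w M).comp measurable_snd
    have hp2 : Measurable (fun p : EuclideanSpace ℝ (Fin n × Fin m) ×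
        EuclideanSpace ℝ (Fin n × Fin m) => (marg n m (piSVS n m) w p.2)⁻¹) :=
      (hmw.comp measurable_snd).inv
    have hp3 : Measurable (fun p : EuclideanSpace ℝ (Fin n × Fin m) ×
        EuclideanSpace ℝ (Fin n × Fin m) => ENNReal.ofReal (pdens n m t p.2 p.1)) := by
      unfold pdens
      fun_prop
    have hp4 : Measurable (fun p : EuclideanSpace ℝ (Fin n × Fin m) ×
        EuclideanSpace ℝ (Fin n × Fin m) => marg n m (piSVS n m) v₁ p.1) :=
      hm1.comp measurable_fst
    exact ((hp1.mul hp2).mul (hp3.mul hp4)).aemeasurable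

lemma ratio_lt_one (n m : ℕ) (hm : 1 ≤ m) (hnm : m + 2 ≤ n) {w s : ℝ} (hw : 0 < w) (hs : 0 < s)
    (M : EuclideanSpace ℝ (Fin n × Fin m)) :
    ∫⁻ W : EuclideanSpace ℝ (Fin n × Fin m), ENNReal.ofReal (pdens n m w W M) *
        (marg n m (piSVS n m) (w + s) W / marg n m (piSVS n m) w W) < 1 := by
  have hpi := piSVS_measurable n m hnm
  have hm1 : Measurable (marg n m (piSVS n m) (w + s)) := marg_measurable n m _ _ hpi
  have hmw : Measurable (marg n m (piSVS n m) w) := marg_measurable n m w _ hpi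
  by_contra hcon
  rw [not_lt] at hcon
  have hle : ∀ W : EuclideanSpace ℝ (Fin n × Fin m), ENNReal.ofReal (pdens n m w W M) *
        (marg n m (piSVS n m) (w + s) W / marg n m (piSVS n m) w W) ≤
        ENNReal.ofReal (pdens n m w W M) := by
    intro W
    refine mul_le_of_le_one_right (zero_le) ?_
    exact ENNReal.div_le_of_le_mul (by rw [one_mul]; exact marg_antitone n m hnm hw hs W)
  have h1 := pdens_lintegral n m hw M
  have hae := ae_eq_of_ae_le_of_lintegral_le (Filter.Eventually.of_forall hle)
    (ne_top_of_le_ne_top ENNReal.one_ne_top (h1 ▸ lintegral_mono hle))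
    (pdens_meas_left n m w M).aemeasurable (h1 ▸ hcon)
  have hae2 : ∀ᵐ W : EuclideanSpace ℝ (Fin n × Fin m),
      marg n m (piSVS n m) (w + s) W = marg n m (piSVS n m) w W := by
    filter_upwards [hae] with W hW
    have hp0 : ENNReal.ofReal (pdens n m w W M) ≠ 0 :=
      (ENNReal.ofReal_pos.2 (pdens_pos n m hw W M)).ne'
    have h2 : ENNReal.ofReal (pdens n m w W M) *
        (marg n m (piSVS n m) (w + s) W / marg n m (piSVS n m) w W) =
        ENNReal.ofReal (pdens n m w W M) * 1 := by rw [mul_one]; exact hW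
    have h3 := (ENNReal.mul_right_inj hp0 ENNReal.ofReal_ne_top).1 h2
    rwa [ENNReal.div_eq_one_iff (marg_pos n m hnm hw W).ne' (marg_ne_top n m hnm hw W)] at h3
  have h5 : marg n m (marg n m (piSVS n m) (w + s)) 1 0 = marg n m (marg n m (piSVS n m) w) 1 0 := by
    unfold marg at hae2 ⊢
    refine lintegral_congr_ae ?_
    filter_upwards [hae2] with W hW
    rw [hW]
  rw [marg_semigroup n m one_pos (by positivity) _ hpi,
    marg_semigroup n m one_pos hw _ hpi] at h5
  exact marg_zero_strict n m hm hnm (by positivity : (0 : ℝ) < 1 + w) (by linarith) h5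

lemma quad_pdens_integrable (n m : ℕ) {v : ℝ} (hv : 0 < v)
    (M : EuclideanSpace ℝ (Fin n × Fin m)) :
    Integrable (fun Y : EuclideanSpace ℝ (Fin n × Fin m) => pdens n m v Y M * (1 + ‖Y‖ ^ 2)) := by
  have hp : 0 < 2 * Real.pi * v := by positivity
  have hp2 : 0 < 2 * Real.pi * (2 * v) := by positivity
  set C : ℝ := (2 * Real.pi * v) ^ (-((n : ℝ) * m) / 2) /
    (2 * Real.pi * (2 * v)) ^ (-((n : ℝ) * m) / 2) * (1 + 2 * ‖M‖ ^ 2 + 8 * v)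
  refine Integrable.mono' ((pdens_integrable n m (by positivity : 0 < 2 * v) M).const_mul C) ?_ ?_
  · have : Measurable (fun Y : EuclideanSpace ℝ (Fin n × Fin m) =>
      pdens n m v Y M * (1 + ‖Y‖ ^ 2)) := by
      unfold pdens
      fun_prop
    exact this.aestronglyMeasurable
  · refine Filter.Eventually.of_forall fun Y => ?_
    have hpos : 0 ≤ pdens n m v Y M * (1 + ‖Y‖ ^ 2) :=
      mul_nonneg (pdens_pos n m hv Y M).le (by positivity)
    rw [Real.norm_of_nonneg hpos]
    have h1 : ‖Y‖ ≤ ‖Y - M‖ + ‖M‖ := by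
      calc ‖Y‖ = ‖(Y - M) + M‖ := by rw [sub_add_cancel]
        _ ≤ _ := norm_add_le _ _
    have h2 : ‖Y‖ ^ 2 ≤ 2 * ‖Y - M‖ ^ 2 + 2 * ‖M‖ ^ 2 := by
      nlinarith [norm_nonneg Y, norm_nonneg M, norm_nonneg (Y - M),
        sq_nonneg (‖Y - M‖ - ‖M‖)]
    set x := ‖Y - M‖ ^ 2 / (4 * v) with hx
    have hx0 : 0 ≤ x := by positivity
    have hxe : ‖Y - M‖ ^ 2 = 4 * v * x := by rw [hx]; field_simp
    have h3 : 1 + ‖Y‖ ^ 2 ≤ (1 + 2 * ‖M‖ ^ 2 + 8 * v) * Real.exp x := by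
      have h4 : x + 1 ≤ Real.exp x := Real.add_one_le_exp x
      have h5 : 1 + ‖Y‖ ^ 2 ≤ (1 + 2 * ‖M‖ ^ 2 + 8 * v) * (x + 1) := by
        nlinarith [mul_nonneg (sq_nonneg ‖M‖) hx0, mul_nonneg hv.le hx0]
      exact h5.trans (mul_le_mul_of_nonneg_left h4 (by positivity))
    have e1 : -‖Y - M‖ ^ 2 / (2 * v) = -x + -x := by rw [hxe]; field_simp; ring
    have e2 : -‖Y - M‖ ^ 2 / (2 * (2 * v)) = -x := by rw [hxe]; field_simp; ring
    refine (mul_le_mul_of_nonneg_left h3 (pdens_pos n m hv Y M).le).trans (le_of_eq ?_)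
    unfold pdens
    rw [e1, e2, Real.exp_add]
    have hc : (2 * Real.pi * (2 * v)) ^ (-((n : ℝ) * m) / 2) ≠ 0 := by positivity
    have he : Real.exp (-x) * Real.exp x = 1 := by rw [← Real.exp_add]; simp
    simp only [C]
    field_simp
    linear_combination he

/-- Quadratic growth bound. -/
def QB (n m : ℕ) (G : EuclideanSpace ℝ (Fin n × Fin m) × EuclideanSpace ℝ (Fin n × Fin m) → ℝ) :
    Prop :=
  ∃ K : ℝ, 0 ≤ K ∧ ∀ p, |G p| ≤ K * (1 + ‖p.1‖ ^ 2 + ‖p.2‖ ^ 2)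

lemma QB.sub {n m : ℕ}
    {G H : EuclideanSpace ℝ (Fin n × Fin m) × EuclideanSpace ℝ (Fin n × Fin m) → ℝ}
    (hG : QB n m G) (hH : QB n m H) : QB n m (fun p => G p - H p) := by
  obtain ⟨K, hK, h⟩ := hG
  obtain ⟨L, hL, h'⟩ := hH
  refine ⟨K + L, by positivity, fun p => ?_⟩
  have := abs_sub (G p) (H p)
  linarith [h p, h' p]

lemma QB.integrable {n m : ℕ} {v₁ v₂ : ℝ} (hv₁ : 0 < v₁) (hv₂ : 0 < v₂)
    (M : EuclideanSpace ℝ (Fin n × Fin m))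
    {G : EuclideanSpace ℝ (Fin n × Fin m) × EuclideanSpace ℝ (Fin n × Fin m) → ℝ}
    (hG : QB n m G) (hmeas : Measurable G) :
    Integrable (fun p : EuclideanSpace ℝ (Fin n × Fin m) × EuclideanSpace ℝ (Fin n × Fin m) =>
      pdens n m v₁ p.1 M * pdens n m v₂ p.2 M * G p) := by
  obtain ⟨K, hK, h⟩ := hG
  have hI := ((quad_pdens_integrable n m hv₁ M).mul_prod (quad_pdens_integrable n m hv₂ M)).const_mul K
  refine Integrable.mono' hI ?_ ?_
  · have h1 : Measurable (fun p : EuclideanSpace ℝ (Fin n × Fin m) ×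
        EuclideanSpace ℝ (Fin n × Fin m) => pdens n m v₁ p.1 M) := by
      unfold pdens
      fun_prop
    have h2 : Measurable (fun p : EuclideanSpace ℝ (Fin n × Fin m) ×
        EuclideanSpace ℝ (Fin n × Fin m) => pdens n m v₂ p.2 M) := by
      unfold pdens
      fun_prop
    exact ((h1.mul h2).mul hmeas).aestronglyMeasurable
  · refine Filter.Eventually.of_forall fun p => ?_
    have h1 := pdens_pos n m hv₁ p.1 M
    have h2 := pdens_pos n m hv₂ p.2 M
    rw [norm_mul, Real.norm_of_nonneg (mul_pos h1 h2).le, Real.norm_eq_abs]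
    have h3 : |G p| ≤ K * ((1 + ‖p.1‖ ^ 2) * (1 + ‖p.2‖ ^ 2)) := by
      refine (h p).trans (mul_le_mul_of_nonneg_left ?_ hK)
      nlinarith [mul_nonneg (sq_nonneg ‖p.1‖) (sq_nonneg ‖p.2‖)]
    refine (mul_le_mul_of_nonneg_left h3 (mul_pos h1 h2).le).trans (le_of_eq ?_)
    ring

lemma log_pdens_bound (n m : ℕ) {v : ℝ} (hv : 0 < v) :
    ∃ K : ℝ, 0 ≤ K ∧ ∀ X M : EuclideanSpace ℝ (Fin n × Fin m),
      |Real.log (pdens n m v X M)| ≤ K * (1 + ‖X‖ ^ 2 + ‖M‖ ^ 2) := by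
  have hp : 0 < 2 * Real.pi * v := by positivity
  set c := (2 * Real.pi * v) ^ (-((n : ℝ) * m) / 2) with hc
  have hc0 : 0 < c := by positivity
  refine ⟨|Real.log c| + 1 / v, by positivity, fun X M => ?_⟩
  unfold pdens
  rw [← hc, Real.log_mul hc0.ne' (Real.exp_pos _).ne', Real.log_exp]
  refine (abs_add_le _ _).trans ?_
  have h1 : ‖X - M‖ ≤ ‖X‖ + ‖M‖ := norm_sub_le _ _
  have h2 : ‖X - M‖ ^ 2 ≤ 2 * ‖X‖ ^ 2 + 2 * ‖M‖ ^ 2 := by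
    nlinarith [norm_nonneg X, norm_nonneg M, norm_nonneg (X - M), sq_nonneg (‖X‖ - ‖M‖)]
  have h3 : |-‖X - M‖ ^ 2 / (2 * v)| ≤ 1 / v * (‖X‖ ^ 2 + ‖M‖ ^ 2) := by
    rw [neg_div, abs_neg, abs_of_nonneg (by positivity)]
    rw [div_mul_eq_mul_div, one_mul, div_le_div_iff₀ (by positivity) hv]
    nlinarith
  have h4 : 0 ≤ |Real.log c| * (‖X‖ ^ 2 + ‖M‖ ^ 2) := by positivity
  have h5 : 0 < 1 / v := by positivity
  nlinarith

lemma log_marg_bound (n m : ℕ) (hnm : m + 2 ≤ n) {v : ℝ} (hv : 0 < v) :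
    ∃ K : ℝ, 0 ≤ K ∧ ∀ Z : EuclideanSpace ℝ (Fin n × Fin m),
      |Real.log (marg n m (piSVS n m) v Z).toReal| ≤ K * (1 + ‖Z‖ ^ 2) := by
  have hpos : ∀ {v : ℝ} (_ : 0 < v) (Z : EuclideanSpace ℝ (Fin n × Fin m)),
      0 < (marg n m (piSVS n m) v Z).toReal := fun hv Z =>
    ENNReal.toReal_pos (marg_pos n m hnm hv Z).ne' (marg_ne_top n m hnm hv Z)
  have hcmp : ∀ {v : ℝ} (_ : 0 < v) (Z N : EuclideanSpace ℝ (Fin n × Fin m)),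
      Real.log (marg n m (piSVS n m) v Z).toReal ≤ Real.log ((2 : ℝ) ^ ((n : ℝ) * m / 2)) +
        ‖Z - N‖ ^ 2 / (2 * v) + Real.log (marg n m (piSVS n m) (2 * v) N).toReal := by
    intro v hv Z N
    have h2v : 0 < 2 * v := by positivity
    have h := ENNReal.toReal_mono (ENNReal.mul_ne_top ENNReal.ofReal_ne_top
      (marg_ne_top n m hnm h2v N)) (marg_compare n m hv (piSVS n m) Z N)
    rw [ENNReal.toReal_mul, ENNReal.toReal_ofReal (by positivity)] at h
    have h' := Real.log_le_log (hpos hv Z) h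
    rwa [Real.log_mul (by positivity) (hpos h2v N).ne', Real.log_mul (by positivity)
      (Real.exp_pos _).ne', Real.log_exp] at h'
  set c := Real.log ((2 : ℝ) ^ ((n : ℝ) * m / 2))
  set A := Real.log (marg n m (piSVS n m) (2 * v) 0).toReal
  set B := Real.log (marg n m (piSVS n m) (v / 2) 0).toReal
  refine ⟨|c| + |A| + |B| + 1 / v, by positivity, fun Z => ?_⟩
  have hu := hcmp hv Z 0
  have hl := hcmp (half_pos hv) 0 Z
  rw [show 2 * (v / 2) = v by ring, zero_sub, norm_neg] at hl
  rw [sub_zero] at hu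
  have e : ‖Z‖ ^ 2 / (2 * v) ≤ 1 / v * ‖Z‖ ^ 2 := by
    rw [div_mul_eq_mul_div, one_mul]
    exact div_le_div_of_nonneg_left (by positivity) hv (by linarith)
  have e' : ‖Z‖ ^ 2 / v = 1 / v * ‖Z‖ ^ 2 := by ring
  have h1 := le_abs_self c
  have h2 := le_abs_self A
  have h3 := neg_abs_le B
  have h4 : 0 ≤ (|c| + |A| + |B|) * ‖Z‖ ^ 2 := by positivity
  have h5 : 0 < 1 / v := by positivity
  have h6 := abs_nonneg A
  have h7 := abs_nonneg B
  rw [abs_le]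
  constructor
  · rw [e'] at hl
    change B ≤ _ at hl
    linarith
  · change _ ≤ c + _ + A at hu
    linarith

lemma predPi_eq (n m : ℕ) {v₁ v₂ : ℝ} (hv₁ : 0 < v₁) (hv₂ : 0 < v₂)
    (Y Yt : EuclideanSpace ℝ (Fin n × Fin m)) :
    predPi n m (piSVS n m) v₁ v₂ Y Yt = pdens n m (v₁ + v₂) Yt Y *
      (marg n m (piSVS n m) (v₁ * v₂ / (v₁ + v₂))
          ((v₂ / (v₁ + v₂)) • Y + (v₁ / (v₁ + v₂)) • Yt)).toReal /
      (marg n m (piSVS n m) v₁ Y).toReal := by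
  have hs : 0 < v₁ + v₂ := by positivity
  unfold predPi
  congr 1
  have h : ∀ M : EuclideanSpace ℝ (Fin n × Fin m),
      ENNReal.ofReal (pdens n m v₂ Yt M * pdens n m v₁ Y M) * piSVS n m M =
      ENNReal.ofReal (pdens n m (v₁ + v₂) Yt Y) *
      (ENNReal.ofReal (pdens n m (v₁ * v₂ / (v₁ + v₂))
        ((v₂ / (v₁ + v₂)) • Y + (v₁ / (v₁ + v₂)) • Yt) M) * piSVS n m M) := by
    intro M
    rw [mul_comm (pdens n m v₂ Yt M), pdens_mul n m hv₁ hv₂ Y Yt M,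
      ENNReal.ofReal_mul (pdens_pos n m hs _ _).le, mul_assoc, pdens_symm n m (v₁ + v₂) Y Yt]
  rw [lintegral_congr h, lintegral_const_mul' _ _ ENNReal.ofReal_ne_top, ENNReal.toReal_mul,
    ENNReal.toReal_ofReal (pdens_pos n m hs _ _).le]
  rfl

lemma risk_strict (n m : ℕ) (hm : 1 ≤ m) (hnm : m + 2 ≤ n)
    {v₁ v₂ : ℝ} (hv₁ : 0 < v₁) (hv₂ : 0 < v₂) (M : EuclideanSpace ℝ (Fin n × Fin m)) :
    RKL n m v₁ v₂ M (predPi n m (piSVS n m) v₁ v₂) < RKL n m v₁ v₂ M (predI n m v₁ v₂) := by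
  have hs : 0 < v₁ + v₂ := by positivity
  have hpi := piSVS_measurable n m hnm
  have hid := ratio_identity n m hnm hv₁ hv₂ M
  have hteq : (v₁ / (v₁ + v₂)) ^ 2 * (v₁ + v₂) + v₁ =
      v₁ * v₂ / (v₁ + v₂) + 2 * (v₁ ^ 2 / (v₁ + v₂)) := by
    field_simp
    ring
  rw [hteq] at hid
  have hw : 0 < v₁ * v₂ / (v₁ + v₂) := by positivity
  have hlt := ratio_lt_one n m hm hnm hw (by positivity : 0 < 2 * (v₁ ^ 2 / (v₁ + v₂))) M
  rw [← hid] at hlt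
  have hpe := predPi_eq n m hv₁ hv₂
  clear hid hteq
  set w := v₁ * v₂ / (v₁ + v₂) with hw_def
  have ha : v₁ / (v₁ + v₂) ≤ 1 := by rw [div_le_one hs]; linarith
  have ha0 : 0 ≤ v₁ / (v₁ + v₂) := by positivity
  have hb : v₂ / (v₁ + v₂) ≤ 1 := by rw [div_le_one hs]; linarith
  have hb0 : 0 ≤ v₂ / (v₁ + v₂) := by positivity
  set a := v₁ / (v₁ + v₂)
  set b := v₂ / (v₁ + v₂)
  have hm1 : Measurable (marg n m (piSVS n m) v₁) := marg_measurable n m v₁ _ hpi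
  have hmw : Measurable (marg n m (piSVS n m) w) := marg_measurable n m w _ hpi
  have hpos : ∀ {v : ℝ} (_ : 0 < v) (Z : EuclideanSpace ℝ (Fin n × Fin m)),
      0 < (marg n m (piSVS n m) v Z).toReal := fun hv Z =>
    ENNReal.toReal_pos (marg_pos n m hnm hv Z).ne' (marg_ne_top n m hnm hv Z)
  -- measurability
  have hWm : Measurable (fun p : EuclideanSpace ℝ (Fin n × Fin m) ×
      EuclideanSpace ℝ (Fin n × Fin m) => b • p.1 + a • p.2) := by fun_prop
  have hA : Measurable (fun p : EuclideanSpace ℝ (Fin n × Fin m) ×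
      EuclideanSpace ℝ (Fin n × Fin m) => (marg n m (piSVS n m) v₁ p.1).toReal) :=
    (hm1.comp measurable_fst).ennreal_toReal
  have hB : Measurable (fun p : EuclideanSpace ℝ (Fin n × Fin m) ×
      EuclideanSpace ℝ (Fin n × Fin m) => (marg n m (piSVS n m) w (b • p.1 + a • p.2)).toReal) :=
    (hmw.comp hWm).ennreal_toReal
  have hP1 : Measurable (fun p : EuclideanSpace ℝ (Fin n × Fin m) ×
      EuclideanSpace ℝ (Fin n × Fin m) => pdens n m v₁ p.1 M) := by
    unfold pdens
    fun_prop
  have hP2 : Measurable (fun p : EuclideanSpace ℝ (Fin n × Fin m) ×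
      EuclideanSpace ℝ (Fin n × Fin m) => pdens n m v₂ p.2 M) := by
    unfold pdens
    fun_prop
  have hP3 : Measurable (fun p : EuclideanSpace ℝ (Fin n × Fin m) ×
      EuclideanSpace ℝ (Fin n × Fin m) => pdens n m (v₁ + v₂) p.2 p.1) := by
    unfold pdens
    fun_prop
  -- quadratic bounds
  have qA : QB n m (fun p => Real.log (marg n m (piSVS n m) v₁ p.1).toReal) := by
    obtain ⟨K, hK, h⟩ := log_marg_bound n m hnm hv₁
    refine ⟨K, hK, fun p => (h p.1).trans (mul_le_mul_of_nonneg_left ?_ hK)⟩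
    nlinarith [sq_nonneg ‖p.2‖]
  have qB : QB n m (fun p => Real.log (marg n m (piSVS n m) w (b • p.1 + a • p.2)).toReal) := by
    obtain ⟨K, hK, h⟩ := log_marg_bound n m hnm hw
    refine ⟨2 * K, by positivity, fun p => (h _).trans ?_⟩
    have h1 : ‖b • p.1 + a • p.2‖ ≤ ‖p.1‖ + ‖p.2‖ := by
      refine (norm_add_le _ _).trans ?_
      rw [norm_smul, norm_smul, Real.norm_of_nonneg ha0, Real.norm_of_nonneg hb0]
      exact add_le_add (mul_le_of_le_one_left (norm_nonneg _) hb)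
        (mul_le_of_le_one_left (norm_nonneg _) ha)
    have h2 : 1 + ‖b • p.1 + a • p.2‖ ^ 2 ≤ 2 * (1 + ‖p.1‖ ^ 2 + ‖p.2‖ ^ 2) := by
      nlinarith [norm_nonneg p.1, norm_nonneg p.2, norm_nonneg (b • p.1 + a • p.2),
        sq_nonneg (‖p.1‖ - ‖p.2‖)]
    calc _ ≤ K * (2 * (1 + ‖p.1‖ ^ 2 + ‖p.2‖ ^ 2)) := mul_le_mul_of_nonneg_left h2 hK
      _ = _ := by ring
  have qP2 : QB n m (fun p => Real.log (pdens n m v₂ p.2 M)) := by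
    obtain ⟨K, hK, h⟩ := log_pdens_bound n m hv₂
    refine ⟨K * (1 + ‖M‖ ^ 2), by positivity, fun p => (h p.2 M).trans ?_⟩
    rw [mul_assoc]
    refine mul_le_mul_of_nonneg_left ?_ hK
    have h1 := mul_nonneg (sq_nonneg ‖M‖) (sq_nonneg ‖p.1‖)
    have h2 := mul_nonneg (sq_nonneg ‖M‖) (sq_nonneg ‖p.2‖)
    nlinarith [sq_nonneg ‖p.1‖]
  have qP3 : QB n m (fun p => Real.log (pdens n m (v₁ + v₂) p.2 p.1)) := by
    obtain ⟨K, hK, h⟩ := log_pdens_bound n m hs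
    refine ⟨K, hK, fun p => (h p.2 p.1).trans (le_of_eq ?_)⟩
    ring
  -- integrability
  have hI1 : Integrable (fun p : EuclideanSpace ℝ (Fin n × Fin m) ×
      EuclideanSpace ℝ (Fin n × Fin m) => pdens n m v₁ p.1 M * pdens n m v₂ p.2 M *
      (Real.log (pdens n m v₂ p.2 M) - Real.log (pdens n m (v₁ + v₂) p.2 p.1))) :=
    (qP2.sub qP3).integrable hv₁ hv₂ M (hP2.log.sub hP3.log)
  have hI2 : Integrable (fun p : EuclideanSpace ℝ (Fin n × Fin m) ×
      EuclideanSpace ℝ (Fin n × Fin m) => pdens n m v₁ p.1 M * pdens n m v₂ p.2 M *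
      (Real.log (marg n m (piSVS n m) v₁ p.1).toReal -
        Real.log (marg n m (piSVS n m) w (b • p.1 + a • p.2)).toReal)) :=
    (qA.sub qB).integrable hv₁ hv₂ M (hA.log.sub hB.log)
  have hI3 : Integrable (fun p : EuclideanSpace ℝ (Fin n × Fin m) ×
      EuclideanSpace ℝ (Fin n × Fin m) => pdens n m v₁ p.1 M * pdens n m v₂ p.2 M) :=
    (pdens_integrable n m hv₁ M).mul_prod (pdens_integrable n m hv₂ M)
  have hI3v : ∫ p : EuclideanSpace ℝ (Fin n × Fin m) ×
      EuclideanSpace ℝ (Fin n × Fin m), pdens n m v₁ p.1 M * pdens n m v₂ p.2 M = 1 := by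
    have := integral_prod_mul (μ := (volume : Measure (EuclideanSpace ℝ (Fin n × Fin m))))
      (ν := (volume : Measure (EuclideanSpace ℝ (Fin n × Fin m))))
      (fun X => pdens n m v₁ X M) (fun X => pdens n m v₂ X M)
    rw [pdens_integral n m hv₁, pdens_integral n m hv₂, one_mul] at this
    exact this
  -- the ratio
  set F : EuclideanSpace ℝ (Fin n × Fin m) × EuclideanSpace ℝ (Fin n × Fin m) → ℝ := fun p =>
    pdens n m v₁ p.1 M * pdens n m v₂ p.2 M * ((marg n m (piSVS n m) v₁ p.1).toReal /
      (marg n m (piSVS n m) w (b • p.1 + a • p.2)).toReal) with hF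
  have hFm : Measurable F := (hP1.mul hP2).mul (hA.div hB)
  have hF0 : ∀ p, 0 ≤ F p := fun p => mul_nonneg
    (mul_pos (pdens_pos n m hv₁ p.1 M) (pdens_pos n m hv₂ p.2 M)).le (by positivity)
  have hFl : ∫⁻ p, ENNReal.ofReal (F p) < 1 := by
    have hFm' : AEMeasurable (fun p => ENNReal.ofReal (F p))
      ((volume : Measure (EuclideanSpace ℝ (Fin n × Fin m))).prod volume) :=
      hFm.ennreal_ofReal.aemeasurable
    rw [Measure.volume_eq_prod, lintegral_prod _ hFm']
    refine lt_of_eq_of_lt ?_ hlt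
    refine lintegral_congr fun Y => lintegral_congr fun Yt => ?_
    simp only [hF]
    rw [ENNReal.ofReal_mul (mul_pos (pdens_pos n m hv₁ Y M) (pdens_pos n m hv₂ Yt M)).le,
      ENNReal.ofReal_div_of_pos (hpos hw _), ENNReal.ofReal_toReal (marg_ne_top n m hnm hv₁ _),
      ENNReal.ofReal_toReal (marg_ne_top n m hnm hw _)]
  have hFi : Integrable F := by
    refine ⟨hFm.aestronglyMeasurable, ?_⟩
    rw [hasFiniteIntegral_iff_ofReal (Filter.Eventually.of_forall hF0)]
    exact hFl.trans ENNReal.one_lt_top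
  have hFv : ∫ p, F p < 1 := by
    rw [integral_eq_lintegral_of_nonneg_ae (Filter.Eventually.of_forall hF0)
      hFm.aestronglyMeasurable]
    have := (ENNReal.toReal_lt_toReal (hFl.trans ENNReal.one_lt_top).ne ENNReal.one_ne_top).2 hFl
    simpa using this
  have hle : ∫ p : EuclideanSpace ℝ (Fin n × Fin m) ×
      EuclideanSpace ℝ (Fin n × Fin m), pdens n m v₁ p.1 M * pdens n m v₂ p.2 M *
      (Real.log (marg n m (piSVS n m) v₁ p.1).toReal -
        Real.log (marg n m (piSVS n m) w (b • p.1 + a • p.2)).toReal) ≤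
      ∫ p : EuclideanSpace ℝ (Fin n × Fin m) × EuclideanSpace ℝ (Fin n × Fin m),
        (F p - pdens n m v₁ p.1 M * pdens n m v₂ p.2 M) := by
    refine integral_mono hI2 (hFi.sub hI3) fun p => ?_
    dsimp only
    have hx : 0 < (marg n m (piSVS n m) v₁ p.1).toReal /
      (marg n m (piSVS n m) w (b • p.1 + a • p.2)).toReal := div_pos (hpos hv₁ _) (hpos hw _)
    have h1 := Real.log_le_sub_one_of_pos hx
    rw [Real.log_div (hpos hv₁ _).ne' (hpos hw _).ne'] at h1
    have h2 := mul_le_mul_of_nonneg_left h1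
      (mul_pos (pdens_pos n m hv₁ p.1 M) (pdens_pos n m hv₂ p.2 M)).le
    refine h2.trans (le_of_eq ?_)
    simp only [hF]
    ring
  rw [integral_sub hFi hI3, hI3v] at hle
  have eI : RKL n m v₁ v₂ M (predI n m v₁ v₂) = ∫ p : EuclideanSpace ℝ (Fin n × Fin m) ×
      EuclideanSpace ℝ (Fin n × Fin m), pdens n m v₁ p.1 M * pdens n m v₂ p.2 M *
      (Real.log (pdens n m v₂ p.2 M) - Real.log (pdens n m (v₁ + v₂) p.2 p.1)) := by
    unfold RKL predI
    refine integral_congr_ae (Filter.Eventually.of_forall fun p => ?_)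
    dsimp only
    rw [Real.log_div (pdens_pos n m hv₂ _ _).ne' (pdens_pos n m hs _ _).ne']
  have eP : RKL n m v₁ v₂ M (predPi n m (piSVS n m) v₁ v₂) =
      ∫ p : EuclideanSpace ℝ (Fin n × Fin m) × EuclideanSpace ℝ (Fin n × Fin m),
      (pdens n m v₁ p.1 M * pdens n m v₂ p.2 M *
      (Real.log (pdens n m v₂ p.2 M) - Real.log (pdens n m (v₁ + v₂) p.2 p.1)) +
      pdens n m v₁ p.1 M * pdens n m v₂ p.2 M *
      (Real.log (marg n m (piSVS n m) v₁ p.1).toReal -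
        Real.log (marg n m (piSVS n m) w (b • p.1 + a • p.2)).toReal)) := by
    unfold RKL
    refine integral_congr_ae (Filter.Eventually.of_forall fun p => ?_)
    dsimp only
    have h3 := pdens_pos n m hs p.2 p.1
    rw [hpe, Real.log_div (pdens_pos n m hv₂ _ _).ne'
      (div_pos (mul_pos h3 (hpos hw _)) (hpos hv₁ _)).ne',
      Real.log_div (mul_pos h3 (hpos hw _)).ne' (hpos hv₁ _).ne',
      Real.log_mul h3.ne' (hpos hw _).ne']
    ring
  rw [eP, integral_add hI1 hI2, ← eI]
  linarith

theorem stmt13 (n m : ℕ) (hm : 1 ≤ m) (hnm : m + 2 ≤ n)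
    (v₁ v₂ : ℝ) (hv₁ : 0 < v₁) (hv₂ : 0 < v₂) :
    (∀ (Z : EuclideanSpace ℝ (Fin n × Fin m)) (v : ℝ), 0 < v →
      0 < marg n m (piSVS n m) v Z ∧ marg n m (piSVS n m) v Z ≠ ⊤) ∧
    (∀ M : EuclideanSpace ℝ (Fin n × Fin m),
      RKL n m v₁ v₂ M (predPi n m (piSVS n m) v₁ v₂) ≤
        RKL n m v₁ v₂ M (predI n m v₁ v₂)) ∧
    (∃ M : EuclideanSpace ℝ (Fin n × Fin m),
      RKL n m v₁ v₂ M (predPi n m (piSVS n m) v₁ v₂) <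
        RKL n m v₁ v₂ M (predI n m v₁ v₂)) := by
  exact ⟨fun Z v hv => ⟨marg_pos n m hnm hv Z, marg_ne_top n m hnm hv Z⟩,
    fun M => (risk_strict n m hm hnm hv₁ hv₂ M).le, ⟨0, risk_strict n m hm hnm hv₁ hv₂ 0⟩⟩
end

section
/- (Theorem 5) Let d ≥ 1 and let Σ₂ and Σ̃ be d×d positive definite matrices. Set Σ₁ = (Σ₂⁻¹ + Σ̃⁻¹)⁻¹, let Σ₁^{1/2} be the positive definite square root of Σ₁, and let U be an orthogonal matrix and Λ a diagonal matrix with Σ₁^{1/2} Σ₂⁻¹ Σ₁^{1/2} = Uᵀ Λ U; then 0 ≺ Λ ≺ I, and set A* = Σ₁^{1/2} Uᵀ (Λ⁻¹ − I)^{1/2}. Let π : ℝ^d → [0,∞] be such that θ ↦ π(A* θ) is superharmonic, with 0 < ∫ φ_{Σ}(z − θ) π(θ) dθ < ∞ for Σ ∈ {Σ₂, Σ₁} and all z, and assume the Kullback–Leibler risks below are finite. Then for every θ₀ ∈ ℝ^d, R_KL(θ₀, p̂_π) ≤ R_KL(θ₀, p̂_I). -/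
open Matrix MeasureTheory Metric ENNReal

/-- A function `f : ℝ^d → [0,∞]` is superharmonic if it is lower semicontinuous, not
identically `+∞`, and its mean over every sphere (with respect to the normalized
`(d-1)`-dimensional Hausdorff surface measure) is at most its value at the center. -/
def SuperharmonicFn (d : ℕ) (f : EuclideanSpace ℝ (Fin d) → ℝ≥0∞) : Prop :=
  LowerSemicontinuous f ∧ (∃ x, f x ≠ ⊤) ∧
    ∀ (x : EuclideanSpace ℝ (Fin d)) (δ : ℝ), 0 < δ →
      ∫⁻ z in sphere x δ, f z
          ∂((μH[(d : ℝ) - 1] (sphere x δ))⁻¹ • μH[(d : ℝ) - 1]) ≤ f x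

/-- The centered Gaussian density on `ℝ^d` with covariance matrix `S`:
`φ_S(x) = (2π)^{-d/2} (det S)^{-1/2} exp(-½ xᵀ S⁻¹ x)`. -/
noncomputable def gaussDensityMat (d : ℕ) (S : Matrix (Fin d) (Fin d) ℝ)
    (x : EuclideanSpace ℝ (Fin d)) : ℝ :=
  (2 * Real.pi) ^ (-(d : ℝ) / 2) * S.det ^ (-(1 : ℝ) / 2) *
    Real.exp (-(1 / 2) * ((fun i => x i) ⬝ᵥ (S⁻¹ *ᵥ fun i => x i)))

/-- The marginal `∫ φ_Σ(z − θ) π(θ) dθ` of a prior `π` under Gaussian noise with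
covariance `Σ`. -/
noncomputable def margMat (d : ℕ) (π : EuclideanSpace ℝ (Fin d) → ℝ≥0∞)
    (S : Matrix (Fin d) (Fin d) ℝ) (z : EuclideanSpace ℝ (Fin d)) : ℝ≥0∞ :=
  ∫⁻ θ, ENNReal.ofReal (gaussDensityMat d S (z - θ)) * π θ

/-- The Bayesian predictive density based on the prior `π`. -/
noncomputable def predPiMat (d : ℕ) (π : EuclideanSpace ℝ (Fin d) → ℝ≥0∞)
    (S₂ St : Matrix (Fin d) (Fin d) ℝ) (y yt : EuclideanSpace ℝ (Fin d)) : ℝ :=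
  (∫⁻ θ, ENNReal.ofReal (gaussDensityMat d St (yt - θ) * gaussDensityMat d S₂ (y - θ)) *
      π θ).toReal / (margMat d π S₂ y).toReal

/-- The Kullback–Leibler risk of a predictive density `p̂(·|·)` at `θ₀`, for observation
covariance `S₂` and future covariance `St`. -/
noncomputable def RKLMat (d : ℕ) (S₂ St : Matrix (Fin d) (Fin d) ℝ)
    (θ₀ : EuclideanSpace ℝ (Fin d))
    (phat : EuclideanSpace ℝ (Fin d) → EuclideanSpace ℝ (Fin d) → ℝ) : ℝ :=
  ∫ p : EuclideanSpace ℝ (Fin d) × EuclideanSpace ℝ (Fin d),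
    gaussDensityMat d S₂ (p.1 - θ₀) * gaussDensityMat d St (p.2 - θ₀) *
      Real.log (gaussDensityMat d St (p.2 - θ₀) / phat p.1 p.2)

lemma aux_sphere_fin (n : ℕ) (δ : ℝ) (hδ : 0 < δ) :
    μH[(n : ℝ)] (sphere (0 : EuclideanSpace ℝ (Fin (n+1))) δ) ≠ ⊤ := by
  let G : Fin (n+1) → ℝ → (Fin n → ℝ) → EuclideanSpace ℝ (Fin (n+1)) :=
    fun i s v => WithLp.toLp 2 (i.insertNth s v)
  let F : Fin (n+1) → ℝ → (Fin n → ℝ) → EuclideanSpace ℝ (Fin (n+1)) :=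
    fun i s v => (δ / ‖G i s v‖) • G i s v
  have hG : ∀ i s, ContDiff ℝ 1 (G i s) := by
    intro i s
    rw [contDiff_euclidean]
    intro j
    refine Fin.succAboveCases i ?_ (fun k => ?_) j
    · simpa [G] using contDiff_const
    · simpa [G] using contDiff_apply ℝ ℝ k
  have hG0 : ∀ i s, s ≠ 0 → ∀ v, G i s v ≠ 0 := by
    intro i s hs v h
    apply hs
    have := congrArg (fun x : EuclideanSpace ℝ (Fin (n+1)) => x i) h
    simpa [G] using this
  have hF : ∀ i s, s ≠ 0 → ContDiff ℝ 1 (F i s) := by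
    intro i s hs
    refine ContDiff.smul (ContDiff.div contDiff_const ((hG i s).norm ℝ (hG0 i s hs)) ?_) (hG i s)
    intro v; simpa using hG0 i s hs v
  have hfin : ∀ i s, s ≠ 0 → μH[(n : ℝ)] (F i s '' Set.Icc (-1) 1) < ⊤ := by
    intro i s hs
    obtain ⟨K, hK⟩ := LocallyLipschitzOn.exists_lipschitzOnWith_of_compact
      (isCompact_Icc (a := (-1 : Fin n → ℝ)) (b := 1)) ((hF i s hs).locallyLipschitz.locallyLipschitzOn)
    refine (hK.hausdorffMeasure_image_le (by positivity)).trans_lt ?_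
    have : (μH[(n : ℝ)] : Measure (Fin n → ℝ)) = volume := by
      simpa using hausdorffMeasure_pi_real (ι := Fin n)
    rw [this]
    refine ENNReal.mul_lt_top (by simp) (isCompact_Icc.measure_lt_top)
  have hcov : sphere (0 : EuclideanSpace ℝ (Fin (n+1))) δ ⊆
      ⋃ i : Fin (n+1), (F i 1 '' Set.Icc (-1) 1 ∪ F i (-1) '' Set.Icc (-1) 1) := by
    intro x hx
    have hx' : ‖x‖ = δ := by simpa using hx
    obtain ⟨i, hi⟩ := Finite.exists_max (fun i => |x i|)
    have hxi : 0 < |x i| := by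
      rcases (abs_nonneg (x i)).lt_or_eq with h | h
      · exact h
      · exfalso
        have : x = 0 := by
          ext j
          have := hi j
          rw [← h] at this
          simpa using this
        rw [this] at hx'; simp at hx'; linarith
    have key : ∀ s : ℝ, s * |x i| = x i → x ∈ F i s '' Set.Icc (-1) 1 := by
      intro s hs
      let v : Fin n → ℝ := fun j => x (i.succAbove j) / |x i|
      have hGx : G i s v = |x i|⁻¹ • x := by
        ext j
        refine Fin.succAboveCases i ?_ (fun k => ?_) j
        · simp [G]; field_simp; linarith
        · simp [G, v]; field_simp
      refine ⟨v, ?_, ?_⟩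
      · have : ∀ j, |v j| ≤ 1 := by
          intro j
          simp only [v, abs_div, abs_abs]
          exact div_le_one_of_le₀ (hi _) (abs_nonneg _)
        exact ⟨fun j => (abs_le.1 (this j)).1, fun j => (abs_le.1 (this j)).2⟩
      · simp only [F]
        rw [hGx, norm_smul, hx', smul_smul]
        have : δ / (‖|x i|⁻¹‖ * δ) * |x i|⁻¹ = 1 := by
          simp; field_simp
        rw [this, one_smul]
    refine Set.mem_iUnion.2 ⟨i, ?_⟩
    rcases le_total 0 (x i) with h | h
    · left; exact key 1 (by rw [abs_of_nonneg h]; ring)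
    · right; exact key (-1) (by rw [abs_of_nonpos h]; ring)
  refine ne_of_lt ((measure_mono hcov).trans_lt ?_)
  refine (measure_iUnion_le _).trans_lt ?_
  rw [tsum_fintype]
  refine ENNReal.sum_lt_top.2 (fun i _ => ?_)
  exact (measure_union_le _ _).trans_lt
    (ENNReal.add_lt_top.2 ⟨hfin i 1 (by norm_num), hfin i (-1) (by norm_num)⟩)

lemma aux_sphere_pos (n : ℕ) (δ : ℝ) (hδ : 0 < δ) :
    μH[(n : ℝ)] (sphere (0 : EuclideanSpace ℝ (Fin (n+1))) δ) ≠ 0 := by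
  let P : EuclideanSpace ℝ (Fin (n+1)) → (Fin n → ℝ) := fun x j => x j.succ
  have hP : LipschitzWith 1 P := by
    refine LipschitzWith.of_dist_le_mul (fun x y => ?_)
    simp only [NNReal.coe_one, one_mul]
    rw [dist_pi_le_iff dist_nonneg]
    intro j
    rw [dist_eq_norm, dist_eq_norm]
    exact PiLp.norm_apply_le (x - y) j.succ
  let V : Set (Fin n → ℝ) := {v | ∑ j, v j ^ 2 < δ ^ 2}
  have hV : IsOpen V := isOpen_lt (by fun_prop) (by fun_prop)
  have hV0 : V.Nonempty := ⟨0, by simp [V]; positivity⟩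
  have hsub : V ⊆ P '' sphere (0 : EuclideanSpace ℝ (Fin (n+1))) δ := by
    intro v hv
    have hv' : ∑ j, v j ^ 2 < δ ^ 2 := hv
    refine ⟨WithLp.toLp 2 (Fin.cons (Real.sqrt (δ^2 - ∑ j, v j ^ 2)) v), ?_, ?_⟩
    · rw [mem_sphere_zero_iff_norm, EuclideanSpace.norm_eq, Fin.sum_univ_succ]
      simp only [Fin.cons_zero, Fin.cons_succ, Real.norm_eq_abs, sq_abs]
      rw [Real.sq_sqrt (by linarith)]
      rw [sub_add_cancel, Real.sqrt_sq hδ.le]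
    · ext j; simp [P]
  have h1 : μH[(n : ℝ)] V ≤ μH[(n : ℝ)] (sphere (0 : EuclideanSpace ℝ (Fin (n+1))) δ) := by
    refine (measure_mono hsub).trans ?_
    simpa using hP.hausdorffMeasure_image_le (d := (n:ℝ)) (by positivity) (sphere (0 : EuclideanSpace ℝ (Fin (n+1))) δ)
  have : (μH[(n : ℝ)] : Measure (Fin n → ℝ)) = volume := by
    simpa using hausdorffMeasure_pi_real (ι := Fin n)
  rw [this] at h1
  exact ((hV.measure_pos volume hV0).trans_le h1).ne'
lemma aux_scale {d : ℕ} (k : ℝ) (hk : 0 ≤ k) (f : EuclideanSpace ℝ (Fin d) → ℝ≥0∞)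
    (hf : Measurable f)
    (hS0 : μH[k] (sphere (0 : EuclideanSpace ℝ (Fin d)) 1) ≠ 0)
    (hS1 : μH[k] (sphere (0 : EuclideanSpace ℝ (Fin d)) 1) ≠ ⊤)
    (x : EuclideanSpace ℝ (Fin d)) (r : ℝ) (hr : 0 < r)
    (h : ∫⁻ z in sphere x r, f z ∂((μH[k] (sphere x r))⁻¹ • μH[k]) ≤ f x) :
    ∫⁻ u in sphere (0 : EuclideanSpace ℝ (Fin d)) 1, f (x + r • u) ∂μH[k] ≤
      μH[k] (sphere (0 : EuclideanSpace ℝ (Fin d)) 1) * f x := by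
  let e : EuclideanSpace ℝ (Fin d) → EuclideanSpace ℝ (Fin d) := fun u => x + r • u
  have he : Measurable e := by
    have : Continuous e := by fun_prop
    exact this.measurable
  have hmap : ∃ c : NNReal, c ≠ 0 ∧ Measure.map e (μH[k]) = (c : ℝ≥0∞) • μH[k] := by
    refine ⟨‖r‖₊⁻¹ ^ k, ?_, ?_⟩
    · have : (0:NNReal) < ‖r‖₊⁻¹ := by simpa using hr.ne'
      exact (NNReal.rpow_pos this).ne'
    have h1 : e = (IsometryEquiv.addLeft x) ∘
        (AffineMap.homothety (0 : EuclideanSpace ℝ (Fin d)) r) := by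
      funext u; simp [e, AffineMap.homothety_apply]
    rw [h1, ← Measure.map_map (IsometryEquiv.addLeft x).continuous.measurable
      (AffineMap.homothety_continuous _ _).measurable,
      map_homothety_hausdorffMeasure hk _ hr.ne', Measure.map_smul,
      IsometryEquiv.map_hausdorffMeasure]
    rfl
  obtain ⟨c, hc0, hc⟩ := hmap
  have hpre : e ⁻¹' sphere x r = sphere 0 1 := by
    ext u
    simp [e, norm_smul, abs_of_pos hr, hr.ne']
  have hms : MeasurableSet (sphere x r) := isClosed_sphere.measurableSet
  have hI : ∫⁻ u in sphere (0 : EuclideanSpace ℝ (Fin d)) 1, f (x + r • u) ∂μH[k] =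
      c * ∫⁻ z in sphere x r, f z ∂μH[k] := by
    rw [← hpre, ← setLIntegral_map hms hf he, hc, Measure.restrict_smul, lintegral_smul_measure]
    rfl
  have hM : μH[k] (sphere (0 : EuclideanSpace ℝ (Fin d)) 1) = c * μH[k] (sphere x r) := by
    rw [← hpre, ← Measure.map_apply he hms, hc]; rfl
  rw [hI, hM, mul_assoc]
  gcongr
  have hM0 : μH[k] (sphere x r) ≠ 0 := by
    intro h0; rw [hM, h0] at hS0; simp at hS0
  have hM1 : μH[k] (sphere x r) ≠ ⊤ := by
    intro h0; rw [hM, h0] at hS1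
    rw [ENNReal.mul_top (by simpa using hc0)] at hS1; simp at hS1
  rw [Measure.restrict_smul, lintegral_smul_measure, smul_eq_mul] at h
  rw [mul_comm, ← ENNReal.div_le_iff_le_mul (Or.inl hM0) (Or.inl hM1), ENNReal.div_eq_inv_mul]
  exact h

set_option maxHeartbeats 2000000 in
/-- Radial averaging. -/
lemma aux_radial {d : ℕ} (σ ν : Measure (EuclideanSpace ℝ (Fin d))) [IsFiniteMeasure σ] [SFinite ν]
    (hσ0 : σ Set.univ ≠ 0)
    (hσS : ∀ᵐ u ∂σ, ‖u‖ = 1)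
    (hσi : ∀ ρ : EuclideanSpace ℝ (Fin d) ≃ₗᵢ[ℝ] EuclideanSpace ℝ (Fin d), MeasurePreserving ρ σ σ)
    (hνi : ∀ ρ : EuclideanSpace ℝ (Fin d) ≃ₗᵢ[ℝ] EuclideanSpace ℝ (Fin d), MeasurePreserving ρ ν ν)
    (hν0 : ν {0} = 0)
    (F : EuclideanSpace ℝ (Fin d) → ℝ≥0∞) (hF : LowerSemicontinuous F) (M : ℝ≥0∞)
    (hM : ∀ r : ℝ, 0 < r → ∫⁻ u, F (r • u) ∂σ ≤ σ Set.univ * M) :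
    ∫⁻ z, F z ∂ν ≤ M * ν Set.univ := by
  have hFm : Measurable F := hF.measurable
  -- the base point
  obtain ⟨u0, hu0⟩ : ∃ u0 : EuclideanSpace ℝ (Fin d), ‖u0‖ = 1 := by
    have : (ae σ).NeBot := ae_neBot.2 (by intro h; simp [h] at hσ0)
    exact hσS.exists
  have hrefl : ∀ v w : EuclideanSpace ℝ (Fin d), ‖v‖ = ‖w‖ →
      ∃ ρ : EuclideanSpace ℝ (Fin d) ≃ₗᵢ[ℝ] EuclideanSpace ℝ (Fin d), ρ v = w := fun v w h =>
    ⟨_, Submodule.reflection_sub h⟩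
  let T : ℝ → Set (EuclideanSpace ℝ (Fin d) × EuclideanSpace ℝ (Fin d)) :=
    fun ε => {p | ‖‖p.2‖ • p.1 - p.2‖ < ε * ‖p.2‖}
  have hT : ∀ ε, MeasurableSet (T ε) := fun ε =>
    (isOpen_lt (by fun_prop) (by fun_prop)).measurableSet
  let K : ℝ → EuclideanSpace ℝ (Fin d) → EuclideanSpace ℝ (Fin d) → ℝ≥0∞ :=
    fun ε u z => (T ε).indicator 1 (u, z)
  have hKm : ∀ ε, Measurable (fun p : EuclideanSpace ℝ (Fin d) × EuclideanSpace ℝ (Fin d) =>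
    K ε p.1 p.2) := fun ε => measurable_one.indicator (hT ε)
  have hKm1 : ∀ ε u, Measurable (fun z => K ε u z) := fun ε u =>
    measurable_one.indicator ((hT ε).preimage (measurable_prodMk_left (x := u)))
  have hKm2 : ∀ ε z, Measurable (fun u => K ε u z) := fun ε z =>
    measurable_one.indicator ((hT ε).preimage (measurable_prodMk_right (y := z)))
  have hKinv : ∀ ε (ρ : EuclideanSpace ℝ (Fin d) ≃ₗᵢ[ℝ] EuclideanSpace ℝ (Fin d)) u z,
      K ε (ρ u) (ρ z) = K ε u z := by
    intro ε ρ u z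
    have : (ρ u, ρ z) ∈ T ε ↔ (u, z) ∈ T ε := by
      simp only [T, Set.mem_ofPred_eq, LinearIsometryEquiv.norm_map]
      rw [← map_smul, ← map_sub, LinearIsometryEquiv.norm_map]
    by_cases hm : (u, z) ∈ T ε
    · simp only [K, Set.indicator_of_mem hm, Set.indicator_of_mem (this.2 hm), Pi.one_apply]
    · simp only [K, Set.indicator_of_notMem hm, Set.indicator_of_notMem (fun h => hm (this.1 h))]
  let h : ℝ → ℝ≥0∞ := fun ε => σ (ball u0 ε)
  have hball : ∀ w : EuclideanSpace ℝ (Fin d), ‖w‖ = 1 → ∀ ε, σ (ball w ε) = h ε := by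
    intro w hw ε
    obtain ⟨ρ, hρ⟩ := hrefl w u0 (by rw [hw, hu0])
    have : ρ ⁻¹' ball u0 ε = ball w ε := by
      rw [← hρ]; exact ρ.isometry.preimage_ball w ε
    rw [← this, (hσi ρ).measure_preimage measurableSet_ball.nullMeasurableSet]
  have hhpos : ∀ ε, 0 < ε → h ε ≠ 0 := by
    intro ε hε h0
    apply hσ0
    obtain ⟨t, hts, htf, htc⟩ := (isCompact_sphere (0 : EuclideanSpace ℝ (Fin d)) 1).finite_cover_balls hε
    have h1 : σ (sphere 0 1) = 0 := by
      refine measure_mono_null htc ((measure_biUnion_null_iff htf.countable).2 (fun w hw => ?_))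
      rw [hball w (by simpa using hts hw), h0]
    have h2 : σ (sphere 0 1)ᶜ = 0 := by
      rw [← mem_ae_iff]
      filter_upwards [hσS] with u hu
      simpa using hu
    rw [← Set.union_compl_self (sphere (0 : EuclideanSpace ℝ (Fin d)) 1)]
    exact measure_union_null h1 h2
  have hhtop : ∀ ε, h ε ≠ ⊤ := fun ε => measure_ne_top _ _
  have hKz : ∀ ε z, z ≠ 0 → ∀ u, K ε u z = (ball (‖z‖⁻¹ • z) ε).indicator 1 u := by
    intro ε z hz u
    have hz' : 0 < ‖z‖ := norm_pos_iff.2 hz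
    have : (u, z) ∈ T ε ↔ u ∈ ball (‖z‖⁻¹ • z) ε := by
      simp only [T, Set.mem_ofPred_eq, mem_ball, dist_eq_norm]
      have : ‖z‖ • u - z = ‖z‖ • (u - ‖z‖⁻¹ • z) := by
        rw [smul_sub, smul_smul, mul_inv_cancel₀ hz'.ne', one_smul]
      rw [this, norm_smul, norm_norm, mul_comm]
      exact mul_lt_mul_iff_left₀ hz'
    by_cases hm : (u, z) ∈ T ε
    · simp only [K, Set.indicator_of_mem hm, Set.indicator_of_mem (this.1 hm), Pi.one_apply]
    · simp only [K, Set.indicator_of_notMem hm, Set.indicator_of_notMem (fun h => hm (this.2 h))]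
  have hunit : ∀ z : EuclideanSpace ℝ (Fin d), z ≠ 0 → ‖‖z‖⁻¹ • z‖ = 1 := by
    intro z hz
    rw [norm_smul, norm_inv, norm_norm, inv_mul_cancel₀ (norm_ne_zero_iff.2 hz)]
  have hKσ : ∀ ε z, z ≠ 0 → ∫⁻ u, K ε u z ∂σ = h ε := by
    intro ε z hz
    simp_rw [hKz ε z hz]
    rw [lintegral_indicator_one measurableSet_ball, hball _ (hunit z hz)]
  have hae0 : ∀ᵐ z ∂ν, z ≠ 0 := by
    rw [ae_iff]; simpa using hν0
  have hK0 : ∀ ε u, K ε u 0 = 0 := by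
    intro ε u; simp [K, T]
  -- rotation
  have hrot : ∀ ε u, ‖u‖ = 1 → ∀ H : ℝ → ℝ≥0∞, Measurable H →
      ∫⁻ z, K ε u z * H ‖z‖ ∂ν = ∫⁻ z, K ε u0 z * H ‖z‖ ∂ν := by
    intro ε u hu H hH
    obtain ⟨ρ, hρ⟩ := hrefl u0 u (by rw [hu, hu0])
    rw [← (hνi ρ).lintegral_comp (f := fun z => K ε u z * H ‖z‖)]
    · refine lintegral_congr (fun z => ?_)
      rw [LinearIsometryEquiv.norm_map, ← hρ, hKinv]
    · exact (hKm1 ε u).mul (hH.comp measurable_norm)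
  -- the constant
  have hconst : ∀ ε, σ Set.univ * ∫⁻ z, K ε u0 z ∂ν = h ε * ν Set.univ := by
    intro ε
    have h1 : ∫⁻ u, ∫⁻ z, K ε u z ∂ν ∂σ = σ Set.univ * ∫⁻ z, K ε u0 z ∂ν := by
      rw [mul_comm, ← lintegral_const]
      refine lintegral_congr_ae ?_
      filter_upwards [hσS] with u hu
      simpa using hrot ε u hu (fun _ => 1) measurable_const
    rw [← h1, lintegral_lintegral_swap (hKm ε).aemeasurable, ← lintegral_const]
    refine lintegral_congr_ae ?_
    filter_upwards [hae0] with z hz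
    exact hKσ ε z hz
  have hmeas2 : Measurable (fun p : EuclideanSpace ℝ (Fin d) × EuclideanSpace ℝ (Fin d) =>
      F (‖p.2‖ • p.1)) := by
    have : Continuous (fun p : EuclideanSpace ℝ (Fin d) × EuclideanSpace ℝ (Fin d) =>
      ‖p.2‖ • p.1) := by fun_prop
    exact hFm.comp this.measurable
  -- main bound
  have hbound : ∀ ε, 0 < ε → ∫⁻ z, (h ε)⁻¹ * ∫⁻ u, K ε u z * F (‖z‖ • u) ∂σ ∂ν ≤ M * ν Set.univ := by
    intro ε hε
    have hm : Measurable (fun p : EuclideanSpace ℝ (Fin d) × EuclideanSpace ℝ (Fin d) =>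
      K ε p.1 p.2 * F (‖p.2‖ • p.1)) := (hKm ε).mul hmeas2
    rw [lintegral_const_mul' _ _ (ENNReal.inv_ne_top.2 (hhpos ε hε))]
    rw [← lintegral_lintegral_swap hm.aemeasurable]
    have h1 : ∫⁻ u, ∫⁻ z, K ε u z * F (‖z‖ • u) ∂ν ∂σ =
        ∫⁻ u, ∫⁻ z, K ε u0 z * F (‖z‖ • u) ∂ν ∂σ := by
      refine lintegral_congr_ae ?_
      filter_upwards [hσS] with u hu
      refine hrot ε u hu (fun r => F (r • u)) ?_
      have : Continuous (fun r : ℝ => r • u) := by fun_prop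
      exact hFm.comp this.measurable
    rw [h1, lintegral_lintegral_swap]
    swap
    · exact (((hKm ε).comp (measurable_const.prodMk measurable_snd)).mul hmeas2).aemeasurable
    have h2 : ∫⁻ z, ∫⁻ u, K ε u0 z * F (‖z‖ • u) ∂σ ∂ν ≤ ∫⁻ z, K ε u0 z * (σ Set.univ * M) ∂ν := by
      refine lintegral_mono (fun z => ?_)
      by_cases hz : z = 0
      · simp [hz, hK0]
      · dsimp only
        rw [lintegral_const_mul' _ _ (by rw [hKz ε z hz]; simp only [Set.indicator]; split_ifs <;> simp)]
        gcongr
        exact hM _ (norm_pos_iff.2 hz)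
    have h3 : ∫⁻ z, K ε u0 z * (σ Set.univ * M) ∂ν = h ε * (M * ν Set.univ) := by
      have hm3 : Measurable (fun z => K ε u0 z) := hKm1 ε u0
      rw [lintegral_mul_const _ hm3]
      calc _ = (σ Set.univ * ∫⁻ z, K ε u0 z ∂ν) * M := by ring
        _ = _ := by rw [hconst]; ring
    calc _ ≤ (h ε)⁻¹ * (h ε * (M * ν Set.univ)) := by gcongr; exact h2.trans h3.le
      _ = M * ν Set.univ := by
        rw [← mul_assoc, ENNReal.inv_mul_cancel (hhpos ε hε) (hhtop ε), one_mul]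
  -- Fatou
  let ε : ℕ → ℝ := fun n => 1 / ((n : ℝ) + 1)
  have hεpos : ∀ n, 0 < ε n := fun n => by simp only [ε]; positivity
  have hpt : ∀ᵐ z ∂ν, F z ≤ Filter.liminf
      (fun n => (h (ε n))⁻¹ * ∫⁻ u, K (ε n) u z * F (‖z‖ • u) ∂σ) Filter.atTop := by
    filter_upwards [hae0] with z hz
    have hz' : 0 < ‖z‖ := norm_pos_iff.2 hz
    refine le_of_forall_lt (fun a ha => ?_)
    obtain ⟨b, hab, hb⟩ := exists_between ha
    refine hab.trans_le ?_
    refine Filter.le_liminf_of_le (by isBoundedDefault) ?_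
    obtain ⟨η, hη, hball'⟩ := Metric.eventually_nhds_iff.1 (hF z b hb)
    have hev : ∀ᶠ n in Filter.atTop, ε n < η / ‖z‖ :=
      (tendsto_one_div_add_atTop_nhds_zero_nat (𝕜 := ℝ)).eventually_lt_const (by positivity)
    filter_upwards [hev] with n hn
    have h1 : b * h (ε n) ≤ ∫⁻ u, K (ε n) u z * F (‖z‖ • u) ∂σ := by
      have hm3 : Measurable (fun u => K (ε n) u z) := hKm2 (ε n) z
      rw [← hKσ (ε n) z hz, ← lintegral_const_mul _ hm3]
      refine lintegral_mono (fun u => ?_)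
      by_cases hu : (u, z) ∈ T (ε n)
      · have : b < F (‖z‖ • u) := by
          refine hball' ?_
          rw [dist_eq_norm]
          have : ‖‖z‖ • u - z‖ < ε n * ‖z‖ := hu
          refine this.trans ?_
          rwa [← lt_div_iff₀ hz']
        simp only [K, Set.indicator_of_mem hu, Pi.one_apply, one_mul, mul_one]
        exact this.le
      · simp [K, hu]
    calc b = (h (ε n))⁻¹ * (b * h (ε n)) := by
          rw [mul_comm b, ← mul_assoc, ENNReal.inv_mul_cancel (hhpos _ (hεpos n)) (hhtop _), one_mul]
      _ ≤ _ := by gcongr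
  calc ∫⁻ z, F z ∂ν ≤ ∫⁻ z, (Filter.liminf
      (fun n => (h (ε n))⁻¹ * ∫⁻ u, K (ε n) u z * F (‖z‖ • u) ∂σ) Filter.atTop) ∂ν :=
        lintegral_mono_ae hpt
    _ ≤ Filter.liminf (fun n => ∫⁻ z, (h (ε n))⁻¹ * ∫⁻ u, K (ε n) u z * F (‖z‖ • u) ∂σ ∂ν)
        Filter.atTop := by
      refine lintegral_liminf_le (fun n => ?_)
      refine Measurable.const_mul ?_ _
      exact Measurable.lintegral_prod_left ((hKm (ε n)).mul hmeas2)
    _ ≤ M * ν Set.univ := by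
      refine Filter.liminf_le_of_le (by isBoundedDefault) (fun b hb => ?_)
      obtain ⟨n, hn⟩ := hb.exists
      exact hn.trans (hbound _ (hεpos n))

lemma gd_pos (d : ℕ) {S : Matrix (Fin d) (Fin d) ℝ} (hS : S.PosDef) (x : EuclideanSpace ℝ (Fin d)) :
    0 < gaussDensityMat d S x := by
  have := hS.det_pos
  unfold gaussDensityMat
  have h2 : (0:ℝ) < 2 * Real.pi := by positivity
  exact mul_pos (mul_pos (Real.rpow_pos_of_pos h2 _) (Real.rpow_pos_of_pos this _)) (Real.exp_pos _)

lemma gd_cont (d : ℕ) (S : Matrix (Fin d) (Fin d) ℝ) : Continuous (gaussDensityMat d S) := by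
  unfold gaussDensityMat
  refine continuous_const.mul (Real.continuous_exp.comp (continuous_const.mul ?_))
  simp only [dotProduct, mulVec]
  fun_prop

lemma gd_meas (d : ℕ) (S : Matrix (Fin d) (Fin d) ℝ) :
    Measurable (fun x => ENNReal.ofReal (gaussDensityMat d S x)) :=
  ENNReal.measurable_ofReal.comp (gd_cont d S).measurable

lemma gd_neg (d : ℕ) (S : Matrix (Fin d) (Fin d) ℝ) (x : EuclideanSpace ℝ (Fin d)) :
    gaussDensityMat d S (-x) = gaussDensityMat d S x := by
  unfold gaussDensityMat
  have : (fun i => (-x) i) = -(fun i => x i) := by ext i; simp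
  rw [this, mulVec_neg, neg_dotProduct_neg]

/-- multiplication by a matrix as a linear map -/
noncomputable abbrev mE {d : ℕ} (A : Matrix (Fin d) (Fin d) ℝ) :
    EuclideanSpace ℝ (Fin d) →ₗ[ℝ] EuclideanSpace ℝ (Fin d) := Matrix.toEuclideanLin A

lemma mE_coe {d : ℕ} (A : Matrix (Fin d) (Fin d) ℝ) (x : EuclideanSpace ℝ (Fin d)) :
    (fun i => (mE A x) i) = A *ᵥ (fun i => x i) := rfl

lemma mE_mul {d : ℕ} (A B : Matrix (Fin d) (Fin d) ℝ) (x : EuclideanSpace ℝ (Fin d)) :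
    mE A (mE B x) = mE (A * B) x := by
  ext i
  have := congrFun (mulVec_mulVec (fun i => x i) A B) i
  exact this

lemma mE_one {d : ℕ} (x : EuclideanSpace ℝ (Fin d)) : mE (1 : Matrix (Fin d) (Fin d) ℝ) x = x := by
  ext i
  exact congrFun (one_mulVec (fun i => x i)) i

lemma mE_det {d : ℕ} (A : Matrix (Fin d) (Fin d) ℝ) : LinearMap.det (mE A) = A.det := by
  change LinearMap.det (Matrix.toLpLin 2 2 A) = A.det
  rw [Matrix.toLpLin_eq_toLin, LinearMap.det_toLin]

lemma mE_cont {d : ℕ} (A : Matrix (Fin d) (Fin d) ℝ) : Continuous (mE A) :=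
  (mE A).continuous_of_finiteDimensional

lemma quad_mul {d : ℕ} (A M : Matrix (Fin d) (Fin d) ℝ) (x : Fin d → ℝ) :
    (A *ᵥ x) ⬝ᵥ (M *ᵥ (A *ᵥ x)) = x ⬝ᵥ ((Aᵀ * M * A) *ᵥ x) := by
  rw [← mulVec_mulVec, ← mulVec_mulVec]
  conv_rhs => rw [dotProduct_mulVec, vecMul_transpose]

lemma gd_lin {d : ℕ} (A S : Matrix (Fin d) (Fin d) ℝ) (hA : A.det ≠ 0) (hS : 0 < S.det)
    (x : EuclideanSpace ℝ (Fin d)) :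
    gaussDensityMat d S x = |A.det| * gaussDensityMat d (A * S * Aᵀ) (mE A x) := by
  unfold gaussDensityMat
  have hAu : IsUnit A.det := isUnit_iff_ne_zero.2 hA
  have hAtu : IsUnit Aᵀ.det := by rwa [det_transpose]
  rw [mE_coe, quad_mul]
  have h1 : Aᵀ * (A * S * Aᵀ)⁻¹ * A = S⁻¹ := by
    rw [Matrix.mul_inv_rev, Matrix.mul_inv_rev, ← mul_assoc, Matrix.mul_nonsing_inv _ hAtu, one_mul,
      mul_assoc, Matrix.nonsing_inv_mul _ hAu, mul_one]
  rw [h1]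
  have h2 : (A * S * Aᵀ).det ^ (-(1:ℝ)/2) = |A.det|⁻¹ * S.det ^ (-(1:ℝ)/2) := by
    rw [det_mul, det_mul, det_transpose]
    have : A.det * S.det * A.det = |A.det| ^ (2:ℝ) * S.det := by
      rw [Real.rpow_two, sq_abs]; ring
    rw [this, Real.mul_rpow (by positivity) hS.le, ← Real.rpow_mul (abs_nonneg _)]
    norm_num
    left
    rw [Real.rpow_neg_one]
  rw [h2]
  have : |A.det| ≠ 0 := abs_ne_zero.2 hA
  field_simp

lemma gd_lintegral {d : ℕ} (A S : Matrix (Fin d) (Fin d) ℝ) (hA : A.det ≠ 0) (hS : 0 < S.det)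
    (g : EuclideanSpace ℝ (Fin d) → ℝ≥0∞) (hg : Measurable g) :
    ∫⁻ x, ENNReal.ofReal (gaussDensityMat d S x) * g (mE A x) =
      ∫⁻ u, ENNReal.ofReal (gaussDensityMat d (A * S * Aᵀ) u) * g u := by
  have hm : Measurable (fun u => ENNReal.ofReal (gaussDensityMat d (A * S * Aᵀ) u) * g u) :=
    (gd_meas d _).mul hg
  have h1 : ∫⁻ x, ENNReal.ofReal (gaussDensityMat d S x) * g (mE A x) =
      ENNReal.ofReal |A.det| * ∫⁻ x, ENNReal.ofReal (gaussDensityMat d (A * S * Aᵀ) (mE A x)) *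
        g (mE A x) := by
    rw [← lintegral_const_mul' _ _ ENNReal.ofReal_ne_top]
    refine lintegral_congr (fun x => ?_)
    rw [gd_lin A S hA hS, ENNReal.ofReal_mul (abs_nonneg _), mul_assoc]
  rw [h1, ← lintegral_map hm (mE_cont A).measurable,
    Measure.map_linearMap_addHaar_eq_smul_addHaar _ (by rwa [mE_det]), lintegral_smul_measure,
    mE_det, smul_eq_mul, ← mul_assoc, ← ENNReal.ofReal_mul (abs_nonneg _), ← abs_mul,
    mul_inv_cancel₀ hA]
  simp

lemma gd_one (d : ℕ) (x : EuclideanSpace ℝ (Fin d)) :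
    gaussDensityMat d 1 x = (2 * Real.pi) ^ (-(d : ℝ) / 2) * Real.exp (-(1/2) * ‖x‖^2) := by
  unfold gaussDensityMat
  have : (fun i => x i) ⬝ᵥ (fun i => x i) = ‖x‖^2 := by
    rw [EuclideanSpace.norm_sq_eq]
    simp [dotProduct, sq]
  simp [this]

lemma gd_one_int (d : ℕ) : ∫⁻ x, ENNReal.ofReal (gaussDensityMat d 1 x) = 1 := by
  have hI := GaussianFourier.integral_rexp_neg_mul_sq_norm (V := EuclideanSpace ℝ (Fin d))
    (b := 1/2) (by norm_num)
  have h2 : (0:ℝ) < 2 * Real.pi := by positivity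
  have h1 : ∫ x, gaussDensityMat d 1 x = 1 := by
    simp_rw [gd_one]
    rw [integral_const_mul, hI, show Real.pi / (1/2) = 2 * Real.pi by ring, ← Real.rpow_add h2]
    simp; ring_nf; simp
  rw [← ofReal_integral_eq_lintegral_ofReal, h1, ENNReal.ofReal_one]
  · by_contra hc
    rw [integral_undef hc] at h1; norm_num at h1
  · exact Filter.Eventually.of_forall (fun x => (gd_pos d Matrix.PosDef.one x).le)

open scoped MatrixOrder Matrix.Norms.L2Operator in
lemma posdef_factor {d : ℕ} {S : Matrix (Fin d) (Fin d) ℝ} (hS : S.PosDef) :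
    ∃ A : Matrix (Fin d) (Fin d) ℝ, A.det ≠ 0 ∧ A * Aᵀ = S := by
  obtain ⟨B, hB⟩ := CStarAlgebra.nonneg_iff_eq_star_mul_self.mp hS.posSemidef.nonneg
  have hB' : S = Bᵀ * B := by rw [hB, star_eq_conjTranspose, conjTranspose_eq_transpose_of_trivial]
  refine ⟨Bᵀ, ?_, by simp [hB']⟩
  intro h
  have := hS.det_pos
  rw [hB', det_mul, h] at this
  simp at this

lemma gd_int {d : ℕ} {S : Matrix (Fin d) (Fin d) ℝ} (hS : S.PosDef) :
    ∫⁻ x, ENNReal.ofReal (gaussDensityMat d S x) = 1 := by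
  obtain ⟨A, hA, rfl⟩ := posdef_factor hS
  have := gd_lintegral A 1 hA (by simp) (fun _ => 1) measurable_const
  simp only [mul_one, gd_one_int] at this
  exact this.symm

lemma mat_par {d : ℕ} {S T : Matrix (Fin d) (Fin d) ℝ} (hS : S.PosDef) (hT : T.PosDef) :
    (S⁻¹ + T⁻¹)⁻¹ = T * (S + T)⁻¹ * S := by
  have hSu := (Matrix.isUnit_iff_isUnit_det _).1 hS.isUnit
  have hTu := (Matrix.isUnit_iff_isUnit_det _).1 hT.isUnit
  have h : S⁻¹ + T⁻¹ = S⁻¹ * (S + T) * T⁻¹ := by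
    rw [mul_add, add_mul, Matrix.nonsing_inv_mul _ hSu, one_mul, mul_assoc,
      Matrix.mul_nonsing_inv _ hTu, mul_one, add_comm]
  rw [h, Matrix.mul_inv_rev, Matrix.mul_inv_rev, Matrix.nonsing_inv_nonsing_inv _ hSu,
    Matrix.nonsing_inv_nonsing_inv _ hTu, mul_assoc]

lemma mat_par' {d : ℕ} {S T : Matrix (Fin d) (Fin d) ℝ} (hS : S.PosDef) (hT : T.PosDef) :
    (S⁻¹ + T⁻¹)⁻¹ = S * (S + T)⁻¹ * T := by
  rw [add_comm, mat_par hT hS, add_comm T S]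

lemma posdef_par {d : ℕ} {S T : Matrix (Fin d) (Fin d) ℝ} (hS : S.PosDef) (hT : T.PosDef) :
    ((S⁻¹ + T⁻¹)⁻¹).PosDef := (hS.inv.add hT.inv).inv

lemma posdef_t {d : ℕ} {S : Matrix (Fin d) (Fin d) ℝ} (hS : S.PosDef) : Sᵀ = S := by
  have := hS.isHermitian
  rwa [Matrix.IsHermitian, conjTranspose_eq_transpose_of_trivial] at this

lemma quad_add {d : ℕ} {M : Matrix (Fin d) (Fin d) ℝ} (hM : Mᵀ = M) (x v : Fin d → ℝ) :
    (x + v) ⬝ᵥ (M *ᵥ (x + v)) = x ⬝ᵥ (M *ᵥ x) + 2 * (x ⬝ᵥ (M *ᵥ v)) + v ⬝ᵥ (M *ᵥ v) := by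
  have : v ⬝ᵥ (M *ᵥ x) = x ⬝ᵥ (M *ᵥ v) := by
    rw [dotProduct_mulVec, ← mulVec_transpose, hM, dotProduct_comm]
  rw [mulVec_add, add_dotProduct, dotProduct_add, dotProduct_add, this]; ring

lemma gd_prod {d : ℕ} {S T : Matrix (Fin d) (Fin d) ℝ} (hS : S.PosDef) (hT : T.PosDef)
    (x v : EuclideanSpace ℝ (Fin d)) :
    gaussDensityMat d S x * gaussDensityMat d T (x + v) =
      gaussDensityMat d ((S⁻¹ + T⁻¹)⁻¹) (x + mE ((S⁻¹ + T⁻¹)⁻¹ * T⁻¹) v) *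
        gaussDensityMat d (S + T) v := by
  have hSu := (Matrix.isUnit_iff_isUnit_det _).1 hS.isUnit
  have hTu := (Matrix.isUnit_iff_isUnit_det _).1 hT.isUnit
  have hST := hS.add hT
  have hSTu := (Matrix.isUnit_iff_isUnit_det _).1 hST.isUnit
  have hP := hS.inv.add hT.inv
  have hPu := (Matrix.isUnit_iff_isUnit_det _).1 hP.isUnit
  set P := S⁻¹ + T⁻¹ with hPdef
  have hdet : S.det * T.det = P⁻¹.det * (S + T).det := by
    rw [mat_par hS hT, det_mul, det_mul, det_nonsing_inv, Ring.inverse_eq_inv']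
    have := hST.det_pos.ne'
    field_simp
  have hinv : T⁻¹ = T⁻¹ * P⁻¹ * T⁻¹ + (S + T)⁻¹ := by
    rw [mat_par hS hT, ← mul_assoc, ← mul_assoc, Matrix.nonsing_inv_mul _ hTu, one_mul]
    have h1 : (S+T)⁻¹ = (S+T)⁻¹ * T * T⁻¹ := by
      rw [mul_assoc, Matrix.mul_nonsing_inv _ hTu, mul_one]
    conv_rhs => rhs; rw [h1]
    rw [← add_mul, ← mul_add, Matrix.nonsing_inv_mul _ hSTu, one_mul]
  have hTt : T⁻¹ᵀ = T⁻¹ := posdef_t hT.inv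
  have hPt : P⁻¹ᵀ = P⁻¹ := posdef_t hP.inv
  have hPt' : Pᵀ = P := posdef_t hP
  have hquad : ∀ a b : Fin d → ℝ, a ⬝ᵥ (S⁻¹ *ᵥ a) + (a + b) ⬝ᵥ (T⁻¹ *ᵥ (a + b)) =
      (a + (P⁻¹ * T⁻¹) *ᵥ b) ⬝ᵥ (P⁻¹⁻¹ *ᵥ (a + (P⁻¹ * T⁻¹) *ᵥ b)) + b ⬝ᵥ ((S + T)⁻¹ *ᵥ b) := by
    intro a b
    rw [Matrix.nonsing_inv_nonsing_inv _ hPu, quad_add hTt, quad_add hPt', quad_mul, mulVec_mulVec,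
      ← mul_assoc, Matrix.mul_nonsing_inv _ hPu, one_mul, transpose_mul, hTt, hPt]
    have h2 : T⁻¹ * P⁻¹ * P * (P⁻¹ * T⁻¹) = T⁻¹ * P⁻¹ * T⁻¹ := by
      rw [mul_assoc (T⁻¹) , Matrix.nonsing_inv_mul _ hPu, mul_one, mul_assoc]
    rw [h2]
    have h3 : b ⬝ᵥ (T⁻¹ *ᵥ b) = b ⬝ᵥ ((T⁻¹ * P⁻¹ * T⁻¹) *ᵥ b) + b ⬝ᵥ ((S + T)⁻¹ *ᵥ b) := by
      rw [← dotProduct_add, ← add_mulVec, ← hinv]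
    rw [h3, hPdef, add_mulVec, dotProduct_add]; ring
  unfold gaussDensityMat
  have e1 : (fun i => (x + v) i) = (fun i => x i) + (fun i => v i) := rfl
  have e2 : (fun i => (x + mE (P⁻¹ * T⁻¹) v) i) =
    (fun i => x i) + (P⁻¹ * T⁻¹) *ᵥ (fun i => v i) := rfl
  rw [e1, e2]
  have hrp : S.det ^ (-(1:ℝ)/2) * T.det ^ (-(1:ℝ)/2) =
      P⁻¹.det ^ (-(1:ℝ)/2) * (S + T).det ^ (-(1:ℝ)/2) := by
    rw [← Real.mul_rpow hS.det_pos.le hT.det_pos.le, hdet,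
      Real.mul_rpow hP.inv.det_pos.le hST.det_pos.le]
  have hq := hquad (fun i => x i) (fun i => v i)
  have hexp : ∀ c s t p q a b a' b' : ℝ, s * t = p * q → a + b = a' + b' →
      c * s * Real.exp (-(1/2) * a) * (c * t * Real.exp (-(1/2) * b)) =
      c * p * Real.exp (-(1/2) * a') * (c * q * Real.exp (-(1/2) * b')) := by
    intro c s t p q a b a' b' h1 h2
    have : ∀ s t a b : ℝ, c * s * Real.exp (-(1/2) * a) * (c * t * Real.exp (-(1/2) * b)) =
        c^2 * (s * t) * Real.exp (-(1/2) * (a + b)) := by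
      intro s t a b
      rw [mul_add, Real.exp_add]; ring
    rw [this, this, h1, h2]
  exact hexp _ _ _ _ _ _ _ _ _ hrp hq

lemma gd_conv {d : ℕ} {S T : Matrix (Fin d) (Fin d) ℝ} (hS : S.PosDef) (hT : T.PosDef)
    (a b : EuclideanSpace ℝ (Fin d)) :
    ∫⁻ u, ENNReal.ofReal (gaussDensityMat d S (b - u)) * ENNReal.ofReal (gaussDensityMat d T (a - u))
      = ENNReal.ofReal (gaussDensityMat d (S + T) (a - b)) := by
  have h1 : ∀ u, ENNReal.ofReal (gaussDensityMat d S (b - u)) *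
      ENNReal.ofReal (gaussDensityMat d T (a - u)) =
      ENNReal.ofReal (gaussDensityMat d ((S⁻¹ + T⁻¹)⁻¹)
        ((b + mE ((S⁻¹ + T⁻¹)⁻¹ * T⁻¹) (a - b)) - u)) *
        ENNReal.ofReal (gaussDensityMat d (S + T) (a - b)) := by
    intro u
    rw [← ENNReal.ofReal_mul (gd_pos d hS _).le, ← ENNReal.ofReal_mul (gd_pos d (posdef_par hS hT) _).le]
    have := gd_prod hS hT (b - u) (a - b)
    rw [show b - u + (a - b) = a - u by abel] at this
    rw [this]
    congr 3
    abel
  simp_rw [h1]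
  rw [lintegral_mul_const' _ _ ENNReal.ofReal_ne_top,
    lintegral_sub_left_eq_self (fun u => ENNReal.ofReal (gaussDensityMat d ((S⁻¹ + T⁻¹)⁻¹) u)),
    gd_int (posdef_par hS hT), one_mul]

lemma super_gauss (d : ℕ) (hd : 1 ≤ d) (f : EuclideanSpace ℝ (Fin d) → ℝ≥0∞)
    (hf : SuperharmonicFn d f) (x : EuclideanSpace ℝ (Fin d)) :
    ∫⁻ t, ENNReal.ofReal (gaussDensityMat d 1 t) * f (x + t) ≤ f x := by
  obtain ⟨hlsc, -, hmean⟩ := hf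
  have hk : (0:ℝ) ≤ (d:ℝ) - 1 := by
    have : (1:ℝ) ≤ d := by exact_mod_cast hd
    linarith
  have hS0 : μH[(d:ℝ) - 1] (sphere (0 : EuclideanSpace ℝ (Fin d)) 1) ≠ 0 := by
    obtain ⟨n, rfl⟩ := Nat.exists_eq_add_of_le' hd
    have := aux_sphere_pos n 1 one_pos
    simpa using this
  have hS1 : μH[(d:ℝ) - 1] (sphere (0 : EuclideanSpace ℝ (Fin d)) 1) ≠ ⊤ := by
    obtain ⟨n, rfl⟩ := Nat.exists_eq_add_of_le' hd
    have := aux_sphere_fin n 1 one_pos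
    simpa using this
  have : Nonempty (Fin d) := ⟨⟨0, hd⟩⟩
  have hSm : MeasurableSet (sphere (0 : EuclideanSpace ℝ (Fin d)) 1) := isClosed_sphere.measurableSet
  let σ : Measure (EuclideanSpace ℝ (Fin d)) :=
    (μH[(d:ℝ) - 1]).restrict (sphere (0 : EuclideanSpace ℝ (Fin d)) 1)
  have hσu : σ Set.univ = μH[(d:ℝ) - 1] (sphere (0 : EuclideanSpace ℝ (Fin d)) 1) := by
    simp [σ]
  have : IsFiniteMeasure σ := ⟨by rw [hσu]; exact hS1.lt_top⟩
  let ν : Measure (EuclideanSpace ℝ (Fin d)) :=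
    volume.withDensity (fun t => ENNReal.ofReal (gaussDensityMat d 1 t))
  have hνu : ν Set.univ = 1 := by
    simp only [ν]
    rw [withDensity_apply _ MeasurableSet.univ, Measure.restrict_univ, gd_one_int]
  have : IsFiniteMeasure ν := ⟨by rw [hνu]; simp⟩
  have hmain := aux_radial σ ν (by rw [hσu]; exact hS0)
    (by
      filter_upwards [ae_restrict_mem hSm] with u hu
      simpa using hu)
    (by
      intro ρ
      have h1 := (ρ.toIsometryEquiv.measurePreserving_hausdorffMeasure ((d:ℝ)-1)).restrict_preimage hSm
      have h2 : ρ.toIsometryEquiv ⁻¹' (sphere (0 : EuclideanSpace ℝ (Fin d)) 1) = sphere 0 1 := by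
        ext u; simp
      rw [h2] at h1
      exact h1)
    (by
      intro ρ
      refine ⟨ρ.continuous.measurable, ?_⟩
      ext s hs
      rw [Measure.map_apply ρ.continuous.measurable hs]
      simp only [ν]
      rw [withDensity_apply _ hs, withDensity_apply _ (ρ.continuous.measurable hs)]
      have hp := (ρ.measurePreserving.restrict_preimage hs)
      rw [← hp.lintegral_comp (gd_meas d 1)]
      refine lintegral_congr (fun t => ?_)
      rw [gd_one, gd_one, LinearIsometryEquiv.norm_map])
    (by
      exact withDensity_absolutelyContinuous _ _ (measure_singleton 0))
    (fun t => f (x + t)) (LowerSemicontinuous.comp (g := fun t => x + t) hlsc (by fun_prop)) (f x)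
    (by
      intro r hr
      rw [hσu]
      exact aux_scale ((d:ℝ)-1) hk f hlsc.measurable hS0 hS1 x r hr (hmean x r hr))
  rw [hνu, mul_one] at hmain
  simp only [ν] at hmain
  have hfm : Measurable (fun t => f (x + t)) := hlsc.measurable.comp (measurable_const_add x)
  rwa [lintegral_withDensity_eq_lintegral_mul _ (gd_meas d 1) hfm] at hmain


lemma marg_meas {d : ℕ} {π : EuclideanSpace ℝ (Fin d) → ℝ≥0∞} (hπ : Measurable π)
    (S : Matrix (Fin d) (Fin d) ℝ) : Measurable (margMat d π S) := by
  unfold margMat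
  refine Measurable.lintegral_prod_right' (f := fun p : EuclideanSpace ℝ (Fin d) × EuclideanSpace ℝ (Fin d) =>
    ENNReal.ofReal (gaussDensityMat d S (p.1 - p.2)) * π p.2) ?_
  exact ((gd_meas d S).comp (measurable_fst.sub measurable_snd)).mul (hπ.comp measurable_snd)

lemma marg_le {d : ℕ} {π : EuclideanSpace ℝ (Fin d) → ℝ≥0∞} (hπ : Measurable π)
    {S T : Matrix (Fin d) (Fin d) ℝ} (hS : S.PosDef) (hT : T.PosDef)
    (H : ∀ u, ∫⁻ θ, ENNReal.ofReal (gaussDensityMat d T (θ - u)) * π θ ≤ π u)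
    (z : EuclideanSpace ℝ (Fin d)) : margMat d π (S + T) z ≤ margMat d π S z := by
  unfold margMat
  have h1 : ∀ θ, ENNReal.ofReal (gaussDensityMat d (S + T) (z - θ)) * π θ =
      ∫⁻ u, ENNReal.ofReal (gaussDensityMat d S (z - u)) *
        ENNReal.ofReal (gaussDensityMat d T (θ - u)) * π θ := by
    intro θ
    rw [lintegral_mul_const, gd_conv hS hT, ← gd_neg, neg_sub]
    exact ((gd_meas d S).comp (measurable_const.sub measurable_id)).mul
      ((gd_meas d T).comp (measurable_const.sub measurable_id))
  simp_rw [h1]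
  rw [lintegral_lintegral_swap]
  · refine lintegral_mono (fun u => ?_)
    simp_rw [mul_assoc]
    rw [lintegral_const_mul' _ _ ENNReal.ofReal_ne_top]
    gcongr
    exact H u
  · refine Measurable.aemeasurable ?_
    exact (((gd_meas d S).comp (measurable_const.sub measurable_snd)).mul
      ((gd_meas d T).comp (measurable_fst.sub measurable_snd))).mul (hπ.comp measurable_fst)

lemma marg_smooth {d : ℕ} {π : EuclideanSpace ℝ (Fin d) → ℝ≥0∞} (hπ : Measurable π)
    {S T : Matrix (Fin d) (Fin d) ℝ}
    (H : ∀ u, ∫⁻ θ, ENNReal.ofReal (gaussDensityMat d T (θ - u)) * π θ ≤ π u)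
    (w : EuclideanSpace ℝ (Fin d)) :
    ∫⁻ u, ENNReal.ofReal (gaussDensityMat d T u) * margMat d π S (w - u) ≤ margMat d π S w := by
  unfold margMat
  have h1 : ∀ u, ENNReal.ofReal (gaussDensityMat d T u) *
      ∫⁻ θ, ENNReal.ofReal (gaussDensityMat d S (w - u - θ)) * π θ =
      ∫⁻ θ, ENNReal.ofReal (gaussDensityMat d S (w - θ)) *
        (ENNReal.ofReal (gaussDensityMat d T u) * π (θ - u)) := by
    intro u
    rw [← lintegral_sub_right_eq_self
      (fun θ => ENNReal.ofReal (gaussDensityMat d S (w - u - θ)) * π θ) u,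
      ← lintegral_const_mul' _ _ ENNReal.ofReal_ne_top]
    refine lintegral_congr (fun θ => ?_)
    rw [show w - u - (θ - u) = w - θ by abel]; ring
  simp_rw [h1]
  rw [lintegral_lintegral_swap]
  · refine lintegral_mono (fun θ => ?_)
    dsimp only
    rw [lintegral_const_mul' _ _ ENNReal.ofReal_ne_top]
    gcongr
    refine le_trans (le_of_eq ?_) (H θ)
    rw [← lintegral_sub_left_eq_self _ θ]
    refine lintegral_congr (fun u => ?_)
    rw [show θ - (θ - u) = u by abel, ← gd_neg, neg_sub]
  · refine Measurable.aemeasurable ?_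
    exact ((gd_meas d S).comp (measurable_const.sub measurable_snd)).mul
      (((gd_meas d T).comp measurable_fst).mul (hπ.comp (measurable_snd.sub measurable_fst)))

/-- The expected ratio is at most one. -/
lemma ratio_le {d : ℕ} {π : EuclideanSpace ℝ (Fin d) → ℝ≥0∞} (hπ : Measurable π)
    {S St S₁ T : Matrix (Fin d) (Fin d) ℝ} (hS : S.PosDef) (hSt : St.PosDef)
    (hS₁ : S₁ = (S⁻¹ + St⁻¹)⁻¹) (hT : T.PosDef) (hST : S₁ + T = S)
    (H : ∀ u, ∫⁻ θ, ENNReal.ofReal (gaussDensityMat d T (θ - u)) * π θ ≤ π u)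
    (θ₀ : EuclideanSpace ℝ (Fin d)) :
    ∫⁻ p : EuclideanSpace ℝ (Fin d) × EuclideanSpace ℝ (Fin d),
      ENNReal.ofReal (gaussDensityMat d S (p.1 - θ₀) * gaussDensityMat d St (p.2 - θ₀)) *
      (margMat d π S p.1 / margMat d π S₁ (p.1 + mE (S₁ * St⁻¹) (p.2 - p.1))) ≤ 1 := by
  have hS1 : S₁.PosDef := by rw [hS₁]; exact posdef_par hS hSt
  have hmS := marg_meas hπ S
  have hmS1 := marg_meas hπ S₁
  have hSSt := hS.add hSt
  set B := S₁ * St⁻¹ with hB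
  have hStu := (Matrix.isUnit_iff_isUnit_det _).1 hSt.isUnit
  have hSStu := (Matrix.isUnit_iff_isUnit_det _).1 hSSt.isUnit
  have hBdet : B.det ≠ 0 := by
    rw [hB, det_mul]
    exact mul_ne_zero hS1.det_pos.ne' hSt.inv.det_pos.ne'
  have hB' : B = S * (S + St)⁻¹ := by
    rw [hB, hS₁, mat_par' hS hSt, mul_assoc, Matrix.mul_nonsing_inv _ hStu, mul_one]
  have hBT : B * (S + St) * Bᵀ = T := by
    have h1 : T = S - S₁ := by rw [← hST]; abel
    have h2 : B * (S + St) = S := by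
      rw [hB', mul_assoc, Matrix.nonsing_inv_mul _ hSStu, mul_one]
    have h3 : Bᵀ = (S + St)⁻¹ * S := by
      rw [hB', transpose_mul, posdef_t hSSt.inv, posdef_t hS]
    have h4 : S₁ = S * (S + St)⁻¹ * St := by rw [hS₁, mat_par' hS hSt]
    rw [h2, h3, h1, h4, ← mul_assoc]
    have h5 : S = S * (S + St)⁻¹ * (S + St) := by
      rw [mul_assoc, Matrix.nonsing_inv_mul _ hSStu, mul_one]
    conv_rhs => lhs; rw [h5]
    rw [← mul_sub, add_sub_cancel_right]
  have hBm : Measurable (mE B) := (mE_cont B).measurable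
  have hmeasR : Measurable (fun p : EuclideanSpace ℝ (Fin d) × EuclideanSpace ℝ (Fin d) =>
      ENNReal.ofReal (gaussDensityMat d S (p.1 - θ₀) * gaussDensityMat d St (p.2 - θ₀)) *
      (margMat d π S p.1 / margMat d π S₁ (p.1 + mE B (p.2 - p.1)))) := by
    refine Measurable.mul ?_ (Measurable.div (hmS.comp measurable_fst) (hmS1.comp
      (measurable_fst.add (hBm.comp (measurable_snd.sub measurable_fst)))))
    refine ENNReal.measurable_ofReal.comp (Measurable.mul
      ((gd_cont d S).measurable.comp (measurable_fst.sub_const _))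
      ((gd_cont d St).measurable.comp (measurable_snd.sub_const _)))
  rw [Measure.volume_eq_prod, lintegral_prod _ hmeasR.aemeasurable]
  have e1 : ∀ y, ∫⁻ yt, ENNReal.ofReal (gaussDensityMat d S (y - θ₀) * gaussDensityMat d St (yt - θ₀)) *
      (margMat d π S y / margMat d π S₁ (y + mE B (yt - y))) =
      ∫⁻ v, ENNReal.ofReal (gaussDensityMat d S₁ (y + mE B v - θ₀)) *
        ENNReal.ofReal (gaussDensityMat d (S + St) v) *
      (margMat d π S y / margMat d π S₁ (y + mE B v)) := by
    intro y
    rw [← lintegral_add_left_eq_self _ y]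
    refine lintegral_congr (fun v => ?_)
    rw [add_sub_cancel_left, show y + v - θ₀ = (y - θ₀) + v by abel, gd_prod hS hSt,
      ENNReal.ofReal_mul (gd_pos d (posdef_par hS hSt) _).le, ← hS₁, ← hB,
      show y - θ₀ + mE B v = y + mE B v - θ₀ by abel]
  simp_rw [e1]
  rw [lintegral_lintegral_swap]
  swap
  · refine Measurable.aemeasurable ?_
    have hw : Measurable (fun p : EuclideanSpace ℝ (Fin d) × EuclideanSpace ℝ (Fin d) =>
      p.1 + mE B p.2) := measurable_fst.add (hBm.comp measurable_snd)
    exact (((gd_meas d S₁).comp (hw.sub_const _)).mul ((gd_meas d (S+St)).comp measurable_snd)).mul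
      ((hmS.comp measurable_fst).div (hmS1.comp hw))
  have e2 : ∀ v, ∫⁻ y, ENNReal.ofReal (gaussDensityMat d S₁ (y + mE B v - θ₀)) *
        ENNReal.ofReal (gaussDensityMat d (S + St) v) *
      (margMat d π S y / margMat d π S₁ (y + mE B v)) =
      ∫⁻ w, ENNReal.ofReal (gaussDensityMat d S₁ (w - θ₀)) *
        ENNReal.ofReal (gaussDensityMat d (S + St) v) *
      (margMat d π S (w - mE B v) / margMat d π S₁ w) := by
    intro v
    rw [← lintegral_sub_right_eq_self _ (mE B v)]
    simp only [sub_add_cancel]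
  simp_rw [e2]
  rw [lintegral_lintegral_swap]
  swap
  · refine Measurable.aemeasurable ?_
    exact (((gd_meas d S₁).comp (measurable_snd.sub_const _)).mul
      ((gd_meas d (S+St)).comp measurable_fst)).mul
      ((hmS.comp (measurable_snd.sub (hBm.comp measurable_fst))).div (hmS1.comp measurable_snd))
  calc _ ≤ ∫⁻ w, ENNReal.ofReal (gaussDensityMat d S₁ (w - θ₀)) := by
        refine lintegral_mono (fun w => ?_)
        have e3 : ∀ v, ENNReal.ofReal (gaussDensityMat d S₁ (w - θ₀)) *
            ENNReal.ofReal (gaussDensityMat d (S + St) v) *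
            (margMat d π S (w - mE B v) / margMat d π S₁ w) =
            ENNReal.ofReal (gaussDensityMat d S₁ (w - θ₀)) *
            ((ENNReal.ofReal (gaussDensityMat d (S + St) v) * margMat d π S (w - mE B v)) *
              (margMat d π S₁ w)⁻¹) := by
          intro v; rw [div_eq_mul_inv]; ring
        simp_rw [e3]
        rw [lintegral_const_mul' _ _ ENNReal.ofReal_ne_top]
        conv_rhs => rw [← mul_one (ENNReal.ofReal _)]
        gcongr
        have hm5 : Measurable (fun u => margMat d π S (w - u)) := hmS.comp (measurable_const.sub measurable_id)
        have hm6 : Measurable (fun v => ENNReal.ofReal (gaussDensityMat d (S + St) v) *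
            margMat d π S (w - mE B v)) := (gd_meas d (S+St)).mul (hm5.comp hBm)
        rw [lintegral_mul_const _ hm6,
          gd_lintegral B (S + St) hBdet hSSt.det_pos (fun u => margMat d π S (w - u)) hm5, hBT,
          ← div_eq_mul_inv]
        refine ENNReal.div_le_of_le_mul ?_
        rw [one_mul]
        refine (marg_smooth hπ H w).trans ?_
        conv_lhs => rw [← hST]
        exact marg_le hπ hS1 hT H w
    _ = 1 := by
        rw [lintegral_sub_right_eq_self (fun w => ENNReal.ofReal (gaussDensityMat d S₁ w)), gd_int hS1]

lemma final_ineq {α : Type*} [MeasurableSpace α] (μ : Measure α) (G X a b : α → ℝ)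
    (hG : ∀ p, 0 < G p) (hGm : Measurable G) (hG1 : ∫⁻ p, ENNReal.ofReal (G p) ∂μ = 1)
    (hX : ∀ p, 0 < X p) (hXm : Measurable X)
    (hGX : ∫⁻ p, ENNReal.ofReal (G p) * ENNReal.ofReal (X p) ∂μ ≤ 1)
    (ha : Integrable (fun p => G p * a p) μ) (hb : Integrable (fun p => G p * b p) μ)
    (hab : ∀ p, b p = a p + Real.log (X p)) :
    ∫ p, G p * b p ∂μ ≤ ∫ p, G p * a p ∂μ := by
  have hGi : Integrable G μ := by
    refine ⟨hGm.aestronglyMeasurable, ?_⟩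
    rw [hasFiniteIntegral_iff_ofReal (Filter.Eventually.of_forall fun p => (hG p).le), hG1]
    exact ENNReal.one_lt_top
  have hGX' : ∫⁻ p, ENNReal.ofReal (G p * X p) ∂μ ≤ 1 := by
    refine le_trans (le_of_eq (lintegral_congr fun p => ?_)) hGX
    exact ENNReal.ofReal_mul (hG p).le
  have hGXi : Integrable (fun p => G p * X p) μ := by
    refine ⟨(hGm.mul hXm).aestronglyMeasurable, ?_⟩
    rw [hasFiniteIntegral_iff_ofReal (Filter.Eventually.of_forall fun p =>
      (mul_pos (hG p) (hX p)).le)]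
    exact hGX'.trans_lt ENNReal.one_lt_top
  have e1 : ∫ p, G p ∂μ = 1 := by
    rw [integral_eq_lintegral_of_nonneg_ae (Filter.Eventually.of_forall fun p => (hG p).le)
      hGm.aestronglyMeasurable, hG1]; simp
  have e2 : ∫ p, G p * X p ∂μ ≤ 1 := by
    rw [integral_eq_lintegral_of_nonneg_ae (Filter.Eventually.of_forall fun p =>
      (mul_pos (hG p) (hX p)).le) (hGm.mul hXm).aestronglyMeasurable]
    exact ENNReal.toReal_le_of_le_ofReal zero_le_one (by simpa using hGX')
  have h : ∫ p, G p * b p ∂μ - ∫ p, G p * a p ∂μ ≤ ∫ p, G p * X p ∂μ - ∫ p, G p ∂μ := by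
    rw [← integral_sub hb ha, ← integral_sub hGXi hGi]
    refine integral_mono (hb.sub ha) (hGXi.sub hGi) (fun p => ?_)
    have h1 := Real.log_le_sub_one_of_pos (hX p)
    have h2 := mul_le_mul_of_nonneg_left h1 (hG p).le
    simp only [hab p]
    linarith
  linarith

lemma pred_eq {d : ℕ} {π : EuclideanSpace ℝ (Fin d) → ℝ≥0∞} 
    {S St S₁ : Matrix (Fin d) (Fin d) ℝ} (hS : S.PosDef) (hSt : St.PosDef)
    (hS₁ : S₁ = (S⁻¹ + St⁻¹)⁻¹) (y yt : EuclideanSpace ℝ (Fin d)) :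
    predPiMat d π S St y yt = gaussDensityMat d (S + St) (yt - y) *
      (margMat d π S₁ (y + mE (S₁ * St⁻¹) (yt - y))).toReal / (margMat d π S y).toReal := by
  unfold predPiMat
  congr 1
  rw [← ENNReal.toReal_ofReal (gd_pos d (hS.add hSt) (yt - y)).le, ← ENNReal.toReal_mul]
  congr 1
  conv_rhs => unfold margMat
  rw [← lintegral_const_mul' _ _ ENNReal.ofReal_ne_top]
  refine lintegral_congr (fun θ => ?_)
  have := gd_prod hS hSt (y - θ) (yt - y)
  rw [show y - θ + (yt - y) = yt - θ by abel, ← hS₁] at this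
  rw [mul_comm (gaussDensityMat d St _), this,
    ENNReal.ofReal_mul' (gd_pos d (hS.add hSt) (yt - y)).le,
    show y - θ + mE (S₁ * St⁻¹) (yt - y) = y + mE (S₁ * St⁻¹) (yt - y) - θ by abel]
  ring

lemma posdef_conj {d : ℕ} {M : Matrix (Fin d) (Fin d) ℝ} (hM : M.PosDef)
    (A : Matrix (Fin d) (Fin d) ℝ) (hA : A.det ≠ 0) : (A * M * Aᵀ).PosDef := by
  have hu : IsUnit A := (Matrix.isUnit_iff_isUnit_det _).2 (isUnit_iff_ne_zero.2 hA)
  have := (Matrix.IsUnit.posDef_star_right_conjugate_iff (x := M) hu).2 hM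
  rwa [star_eq_conjTranspose, conjTranspose_eq_transpose_of_trivial] at this

theorem stmt14 (d : ℕ) (hd : 1 ≤ d)
    (S₂ St : Matrix (Fin d) (Fin d) ℝ) (hS₂ : S₂.PosDef) (hSt : St.PosDef)
    (S₁ : Matrix (Fin d) (Fin d) ℝ) (hS₁ : S₁ = (S₂⁻¹ + St⁻¹)⁻¹)
    (R : Matrix (Fin d) (Fin d) ℝ) (hRpos : R.PosDef) (hRR : R * R = S₁)
    (U : Matrix (Fin d) (Fin d) ℝ) (hU : U ∈ Matrix.orthogonalGroup (Fin d) ℝ)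
    (l : Fin d → ℝ) (Λ : Matrix (Fin d) (Fin d) ℝ) (hΛ : Λ = Matrix.diagonal l)
    (hdecomp : R * S₂⁻¹ * R = Uᵀ * Λ * U)
    (Q : Matrix (Fin d) (Fin d) ℝ) (hQpos : Q.PosSemidef) (hQQ : Q * Q = Λ⁻¹ - 1)
    (Astar : Matrix (Fin d) (Fin d) ℝ) (hAstar : Astar = R * Uᵀ * Q)
    (π : EuclideanSpace ℝ (Fin d) → ℝ≥0∞)
    (hsup : SuperharmonicFn d (fun θ =>
      π ((EuclideanSpace.equiv (Fin d) ℝ).symm (Astar *ᵥ fun i => θ i))))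
    (hmarg : ∀ (S : Matrix (Fin d) (Fin d) ℝ), (S = S₂ ∨ S = S₁) →
      ∀ z, 0 < margMat d π S z ∧ margMat d π S z ≠ ⊤)
    (θ₀ : EuclideanSpace ℝ (Fin d))
    (hintI : Integrable (fun p : EuclideanSpace ℝ (Fin d) × EuclideanSpace ℝ (Fin d) =>
      gaussDensityMat d S₂ (p.1 - θ₀) * gaussDensityMat d St (p.2 - θ₀) *
        Real.log (gaussDensityMat d St (p.2 - θ₀) /
          gaussDensityMat d (S₂ + St) (p.2 - p.1))))
    (hintπ : Integrable (fun p : EuclideanSpace ℝ (Fin d) × EuclideanSpace ℝ (Fin d) =>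
      gaussDensityMat d S₂ (p.1 - θ₀) * gaussDensityMat d St (p.2 - θ₀) *
        Real.log (gaussDensityMat d St (p.2 - θ₀) / predPiMat d π S₂ St p.1 p.2))) :
    (Λ.PosDef ∧ (1 - Λ).PosDef) ∧
    RKLMat d S₂ St θ₀ (predPiMat d π S₂ St) ≤
      RKLMat d S₂ St θ₀ (fun y yt => gaussDensityMat d (S₂ + St) (yt - y)) := by
  have hS1 : S₁.PosDef := by rw [hS₁]; exact posdef_par hS₂ hSt
  have hS2u := (Matrix.isUnit_iff_isUnit_det _).1 hS₂.isUnit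
  have hRu := (Matrix.isUnit_iff_isUnit_det _).1 hRpos.isUnit
  have hRt := posdef_t hRpos
  have hUU : U * Uᵀ = 1 := by
    have := (Matrix.mem_orthogonalGroup_iff (Fin d) ℝ).1 hU
    exact this
  have hUU' : Uᵀ * U = 1 := by
    have := (Matrix.mem_orthogonalGroup_iff' (Fin d) ℝ).1 hU
    exact this
  have hUd : U.det ≠ 0 := by
    intro h
    have := congrArg Matrix.det hUU
    rw [det_mul, h] at this
    simp at this
  have hURd : (U * R).det ≠ 0 := by
    rw [det_mul]; exact mul_ne_zero hUd hRpos.det_pos.ne'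
  have hURt : (U * R)ᵀ = R * Uᵀ := by rw [transpose_mul, hRt]
  have hΛ1 : Λ = (U * R) * S₂⁻¹ * (U * R)ᵀ := by
    calc Λ = (U * Uᵀ) * Λ * (U * Uᵀ) := by rw [hUU, one_mul, mul_one]
      _ = U * (Uᵀ * Λ * U) * Uᵀ := by simp only [mul_assoc]
      _ = _ := by rw [← hdecomp, hURt]; simp only [mul_assoc]
  have hS1inv : S₁⁻¹ = S₂⁻¹ + St⁻¹ := by
    rw [hS₁, Matrix.nonsing_inv_nonsing_inv]
    exact (Matrix.isUnit_iff_isUnit_det _).1 (hS₂.inv.add hSt.inv).isUnit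
  have hRSR : R * S₁⁻¹ * R = 1 := by
    rw [← hRR, Matrix.mul_inv_rev, ← mul_assoc, Matrix.mul_nonsing_inv _ hRu, one_mul,
      Matrix.nonsing_inv_mul _ hRu]
  have hΛ2 : 1 - Λ = (U * R) * St⁻¹ * (U * R)ᵀ := by
    have h1 : (1 : Matrix (Fin d) (Fin d) ℝ) = (U * R) * S₁⁻¹ * (U * R)ᵀ := by
      rw [hURt]
      calc (1 : Matrix (Fin d) (Fin d) ℝ) = U * (R * S₁⁻¹ * R) * Uᵀ := by
            rw [hRSR, mul_one, hUU]
        _ = _ := by simp only [mul_assoc]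
    rw [hΛ1]
    conv_lhs => lhs; rw [h1, hS1inv]
    rw [mul_add, add_mul, add_sub_cancel_left]
  have hΛpos : Λ.PosDef := by rw [hΛ1]; exact posdef_conj hS₂.inv _ hURd
  have hΛpos' : (1 - Λ).PosDef := by rw [hΛ2]; exact posdef_conj hSt.inv _ hURd
  refine ⟨⟨hΛpos, hΛpos'⟩, ?_⟩
  have hΛu := (Matrix.isUnit_iff_isUnit_det _).1 hΛpos.isUnit
  have hQd : Q.det ≠ 0 := by
    intro h
    have h1 : Λ⁻¹ - 1 = Λ⁻¹ * (1 - Λ) := by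
      rw [mul_sub, mul_one, Matrix.nonsing_inv_mul _ hΛu]
    have := congrArg Matrix.det hQQ
    rw [h1, det_mul, det_mul, h, zero_mul] at this
    exact (mul_pos hΛpos.inv.det_pos hΛpos'.det_pos).ne this
  have hQt : Qᵀ = Q := by
    have := hQpos.isHermitian
    rwa [Matrix.IsHermitian, conjTranspose_eq_transpose_of_trivial] at this
  have hAd : Astar.det ≠ 0 := by
    rw [hAstar, det_mul, det_mul, det_transpose]
    exact mul_ne_zero (mul_ne_zero hRpos.det_pos.ne' hUd) hQd
  have hAu := isUnit_iff_ne_zero.2 hAd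
  -- the smoothing covariance
  have hS2eq : R * Uᵀ * Λ⁻¹ * U * R = S₂ := by
    have hURtd : IsUnit (U * R).det := isUnit_iff_ne_zero.2 hURd
    have hURtd' : IsUnit ((U * R)ᵀ).det := by rwa [det_transpose]
    rw [hΛ1, Matrix.mul_inv_rev, Matrix.mul_inv_rev, Matrix.nonsing_inv_nonsing_inv _ hS2u,
      ← hURt, mul_assoc, ← mul_assoc ((U * R)ᵀ), Matrix.mul_nonsing_inv _ hURtd', one_mul,
      mul_assoc, Matrix.nonsing_inv_mul _ hURtd, mul_one]
  have hT : Astar * 1 * Astarᵀ = S₂ - S₁ := by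
    calc Astar * 1 * Astarᵀ = R * Uᵀ * (Q * Q) * U * R := by
          rw [hAstar, mul_one, transpose_mul, transpose_mul, transpose_transpose, hQt, hRt]
          simp only [mul_assoc]
      _ = R * Uᵀ * Λ⁻¹ * U * R - R * (Uᵀ * U) * R := by
          rw [hQQ, mul_sub, sub_mul, sub_mul, mul_one]; simp only [mul_assoc]
      _ = S₂ - S₁ := by rw [hS2eq, hUU', mul_one, hRR]
  have hTpos : (S₂ - S₁).PosDef := by rw [← hT]; exact posdef_conj Matrix.PosDef.one _ hAd
  have hAinv : ∀ x, mE Astar (mE Astar⁻¹ x) = x := fun x => by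
    rw [mE_mul, Matrix.mul_nonsing_inv _ hAu, mE_one]
  have hf : SuperharmonicFn d (fun θ => π (mE Astar θ)) := hsup
  have hπ : Measurable π := by
    have h1 := hf.1.measurable.comp (mE_cont Astar⁻¹).measurable
    have h2 : (fun θ => π (mE Astar θ)) ∘ (mE Astar⁻¹) = π := by
      funext x; simp only [Function.comp, hAinv]
    rwa [h2] at h1
  have H : ∀ u, ∫⁻ θ, ENNReal.ofReal (gaussDensityMat d (S₂ - S₁) (θ - u)) * π θ ≤ π u := by
    intro u
    have h1 := super_gauss d hd _ hf (mE Astar⁻¹ u)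
    simp only [map_add, hAinv] at h1
    rw [gd_lintegral Astar 1 hAd (by simp) (fun z => π (u + z))
      (hπ.comp (measurable_const_add u)), hT] at h1
    rw [← lintegral_add_left_eq_self _ u]
    simpa only [add_sub_cancel_left] using h1
  have hratio := ratio_le hπ hS₂ hSt hS₁ hTpos (by abel) H θ₀
  have hm2 := hmarg S₂ (Or.inl rfl)
  have hm1 := hmarg S₁ (Or.inr rfl)
  have hw : Measurable (fun p : EuclideanSpace ℝ (Fin d) × EuclideanSpace ℝ (Fin d) =>
      p.1 + mE (S₁ * St⁻¹) (p.2 - p.1)) :=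
    measurable_fst.add ((mE_cont _).measurable.comp (measurable_snd.sub measurable_fst))
  unfold RKLMat
  refine final_ineq volume
    (fun p : EuclideanSpace ℝ (Fin d) × EuclideanSpace ℝ (Fin d) =>
      gaussDensityMat d S₂ (p.1 - θ₀) * gaussDensityMat d St (p.2 - θ₀))
    (fun p => (margMat d π S₂ p.1 / margMat d π S₁ (p.1 + mE (S₁ * St⁻¹) (p.2 - p.1))).toReal)
    _ _ (fun p => mul_pos (gd_pos d hS₂ _) (gd_pos d hSt _)) ?_ ?_ ?_ ?_ ?_ hintI hintπ ?_
  · exact ((gd_cont d S₂).measurable.comp (measurable_fst.sub_const _)).mul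
      ((gd_cont d St).measurable.comp (measurable_snd.sub_const _))
  · have h1 : ∀ p : EuclideanSpace ℝ (Fin d) × EuclideanSpace ℝ (Fin d),
        ENNReal.ofReal (gaussDensityMat d S₂ (p.1 - θ₀) * gaussDensityMat d St (p.2 - θ₀)) =
        ENNReal.ofReal (gaussDensityMat d S₂ (p.1 - θ₀)) *
          ENNReal.ofReal (gaussDensityMat d St (p.2 - θ₀)) :=
      fun p => ENNReal.ofReal_mul (gd_pos d hS₂ _).le
    simp_rw [h1]
    rw [Measure.volume_eq_prod, lintegral_prod_mul
      (f := fun y => ENNReal.ofReal (gaussDensityMat d S₂ (y - θ₀)))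
      (g := fun y => ENNReal.ofReal (gaussDensityMat d St (y - θ₀)))
      ((gd_meas d S₂).comp (measurable_id.sub_const _)).aemeasurable
      ((gd_meas d St).comp (measurable_id.sub_const _)).aemeasurable,
      lintegral_sub_right_eq_self (fun w => ENNReal.ofReal (gaussDensityMat d S₂ w)),
      lintegral_sub_right_eq_self (fun w => ENNReal.ofReal (gaussDensityMat d St w)),
      gd_int hS₂, gd_int hSt, one_mul]
  · intro p
    exact ENNReal.toReal_pos (ENNReal.div_pos (hm2 _).1.ne' (hm1 _).2).ne'
      (ENNReal.div_ne_top (hm2 _).2 (hm1 _).1.ne')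
  · exact (((marg_meas hπ S₂).comp measurable_fst).div
      ((marg_meas hπ S₁).comp hw)).ennreal_toReal
  · refine le_trans (le_of_eq (lintegral_congr fun p => ?_)) hratio
    rw [ENNReal.ofReal_toReal (ENNReal.div_ne_top (hm2 _).2 (hm1 _).1.ne')]
  · intro p
    dsimp only
    rw [pred_eq hS₂ hSt hS₁, ENNReal.toReal_div]
    have a1 := gd_pos d hSt (p.2 - θ₀)
    have a2 := gd_pos d (hS₂.add hSt) (p.2 - p.1)
    have a3 := ENNReal.toReal_pos (hm2 p.1).1.ne' (hm2 p.1).2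
    have a4 := ENNReal.toReal_pos (hm1 (p.1 + mE (S₁ * St⁻¹) (p.2 - p.1))).1.ne'
      (hm1 (p.1 + mE (S₁ * St⁻¹) (p.2 - p.1))).2
    rw [← Real.log_mul (div_pos a1 a2).ne' (div_pos a3 a4).ne']
    congr 1
    field_simp
end
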